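/- arXiv:1307.1162 — 3 statements merged into one kernel-verified Lean document; each statement's English description precedes it below -/
import Mathlib

section
/- Let m ∈ ℝ and let ζ : ℝ × ℝ³ → ℝ be a smooth function satisfying the Klein–Gordon equation ∂_t²ζ(t,x) = Δ_xζ(t,x) − m²ζ(t,x) for all (t,x). Let K := supp ζ(0,·) ∪ supp ∂_tζ(0,·) ⊆ ℝ³. Then ζ(t,x) = 0 for every (t,x) with dist(x,K) > |t|. In particular a smooth solution of the Klein–Gordon equation is uniquely determined by its Cauchy data ζ(0,·) and ∂_tζ(0,·), and if the Cauchy data are compactly supported then the support of ζ is contained in the causal shadow J(K) = {(t,x) : dist(x,K) ≤ |t|}, so ζ is space-compact. -/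
open Topology

noncomputable section

/-- Physical space `ℝ³`. -/
abbrev Sp3 := EuclideanSpace ℝ (Fin 3)

/-- The `i`-th coordinate direction in `ℝ³`. -/
def sdir (i : Fin 3) : Sp3 := EuclideanSpace.single i 1

/-- Second partial derivative of `f : ℝ³ → ℝ` in the `i`-th coordinate direction. -/
def pd2 (f : Sp3 → ℝ) (i : Fin 3) (x : Sp3) : ℝ :=
  fderiv ℝ (fun y => fderiv ℝ f y (sdir i)) x (sdir i)

/-- The Laplacian of `f : ℝ³ → ℝ`. -/
def lap (f : Sp3 → ℝ) (x : Sp3) : ℝ := ∑ i, pd2 f i x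

open MeasureTheory Set Metric

/-- The time direction in `ℝ × ℝ³`. -/
def timeDir : ℝ × Sp3 := (1, 0)

/-- The `i`-th spatial direction in `ℝ × ℝ³`. -/
def spaceDir (i : Fin 3) : ℝ × Sp3 := (0, sdir i)

/-- The directional derivative of a function on `ℝ × ℝ³`. -/
def dirDeriv (v : ℝ × Sp3) (f : ℝ × Sp3 → ℝ) (p : ℝ × Sp3) : ℝ := fderiv ℝ f p v

section DirDeriv

variable {f g : ℝ × Sp3 → ℝ} {p v w : ℝ × Sp3}

lemma dirDeriv_mul (hf : DifferentiableAt ℝ f p) (hg : DifferentiableAt ℝ g p) :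
    dirDeriv v (fun q => f q * g q) p = f p * dirDeriv v g p + g p * dirDeriv v f p := by
  simp [dirDeriv, fderiv_fun_mul hf hg]

lemma dirDeriv_add (hf : DifferentiableAt ℝ f p) (hg : DifferentiableAt ℝ g p) :
    dirDeriv v (fun q => f q + g q) p = dirDeriv v f p + dirDeriv v g p := by
  simp [dirDeriv, fderiv_fun_add hf hg]

lemma ContDiff.dirDeriv {n : ℕ∞} (hf : ContDiff ℝ (⊤ : ℕ∞) f) (v : ℝ × Sp3) :
    ContDiff ℝ n (dirDeriv v f) :=
  (hf.fderiv_right (m := n) (by exact_mod_cast le_top)).clm_apply contDiff_const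

lemma dirDeriv_comm (hf : ContDiff ℝ (⊤ : ℕ∞) f) :
    dirDeriv v (dirDeriv w f) p = dirDeriv w (dirDeriv v f) p := by
  have hd : DifferentiableAt ℝ (fderiv ℝ f) p :=
    ((hf.fderiv_right (m := 1) (by exact WithTop.coe_le_coe.2 le_top)).differentiable (by simp)) p
  have key : ∀ a b : ℝ × Sp3, dirDeriv a (dirDeriv b f) p = fderiv ℝ (fderiv ℝ f) p a b := by
    intro a b
    unfold dirDeriv
    rw [fderiv_clm_apply hd (differentiableAt_const b)]
    simp
  rw [key, key]
  exact second_derivative_symmetric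
    (fun y => (hf.differentiable (by simp) y).hasFDerivAt) hd.hasFDerivAt v w

lemma hasDerivAt_time_slice {t : ℝ} {x : Sp3} (hf : DifferentiableAt ℝ f (t, x)) :
    HasDerivAt (fun r => f (r, x)) (dirDeriv timeDir f (t, x)) t :=
  hf.hasFDerivAt.comp_hasDerivAt t ((hasDerivAt_id t).prodMk (hasDerivAt_const t x))

lemma fderiv_space_slice {t : ℝ} {x : Sp3} (hf : DifferentiableAt ℝ f (t, x)) (a : Sp3) :
    fderiv ℝ (fun y => f (t, y)) x a = dirDeriv (0, a) f (t, x) := by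
  have h := hf.hasFDerivAt.comp x ((hasFDerivAt_const t x).prodMk (hasFDerivAt_id x))
  refine (congrArg (fun L => L a) h.fderiv).trans ?_
  simp [dirDeriv]

end DirDeriv

/-- Differentiation under the integral sign for a `C¹` function with uniformly bounded support. -/
lemma hasDerivAt_integral_of_bounded_support {H : ℝ × Sp3 → ℝ} (hH : ContDiff ℝ 1 H)
    {a b r : ℝ} {c : Sp3} (hsupp : ∀ t ∈ Ioo a b, ∀ x ∉ closedBall c r, H (t, x) = 0)
    {t : ℝ} (ht : t ∈ Ioo a b) :
    Integrable (fun x => dirDeriv timeDir H (t, x)) ∧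
      HasDerivAt (fun s => ∫ x, H (s, x)) (∫ x, dirDeriv timeDir H (t, x)) t := by
  have hcont : Continuous (dirDeriv timeDir H) :=
    (hH.continuous_fderiv (by simp)).clm_apply continuous_const
  obtain ⟨C, hC⟩ := ((isCompact_Icc (a := a) (b := b)).prod
    (isCompact_closedBall c r)).exists_bound_of_continuousOn hcont.continuousOn
  have hdiff : ∀ s x, HasDerivAt (fun s => H (s, x)) (dirDeriv timeDir H (s, x)) s := fun s x =>
    hasDerivAt_time_slice (hH.differentiable (by simp) _)
  have hzero : ∀ s ∈ Ioo a b, ∀ x ∉ closedBall c r, dirDeriv timeDir H (s, x) = 0 := by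
    intro s hs x hx
    have hev : (fun s => H (s, x)) =ᶠ[𝓝 s] fun _ => 0 := by
      filter_upwards [isOpen_Ioo.mem_nhds hs] with s' hs' using hsupp s' hs' x hx
    exact (hdiff s x).unique ((hasDerivAt_const s (0 : ℝ)).congr_of_eventuallyEq hev)
  refine hasDerivAt_integral_of_dominated_loc_of_deriv_le (μ := volume)
    (F := fun s x => H (s, x)) (F' := fun s x => dirDeriv timeDir H (s, x))
    (bound := (closedBall c r).indicator fun _ => C)
    (isOpen_Ioo.mem_nhds ht) ?_ ?_ ?_ ?_ ?_ ?_
  · exact .of_forall fun s => (hH.continuous.comp (by fun_prop)).aestronglyMeasurable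
  · exact (hH.continuous.comp (by fun_prop)).integrable_of_hasCompactSupport
      (HasCompactSupport.intro (isCompact_closedBall c r) (hsupp t ht))
  · exact (hcont.comp (by fun_prop)).aestronglyMeasurable
  · refine .of_forall fun x s hs => ?_
    by_cases hx : x ∈ closedBall c r
    · simpa [hx] using hC (s, x) ⟨Ioo_subset_Icc_self hs, hx⟩
    · simp [hx, hzero s hs x hx]
  · exact (integrable_indicator_iff isClosed_closedBall.measurableSet).2
      (integrableOn_const (isCompact_closedBall c r).measure_lt_top.ne)
  · exact .of_forall fun x s _ => hdiff s x

lemma integral_fderiv_eq_zero_of_hasCompactSupport {g : Sp3 → ℝ} (hg : ContDiff ℝ 1 g)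
    (hc : HasCompactSupport g) (v : Sp3) : ∫ x, fderiv ℝ g x v = 0 := by
  have hi : Integrable fun x => fderiv ℝ g x v :=
    ((hg.continuous_fderiv (by simp)).clm_apply continuous_const).integrable_of_hasCompactSupport
      (hc.fderiv_apply (𝕜 := ℝ) v)
  simpa using integral_mul_fderiv_eq_neg_fderiv_mul_of_integrable (μ := volume)
    (f := fun _ : Sp3 => (1 : ℝ)) (g := g) (v := v) (by simp) (by simpa using hi)
    (by simpa using hg.continuous.integrable_of_hasCompactSupport hc)
    (fun x _ => differentiableAt_const _) (fun x _ => hg.differentiable (by simp) x)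

/-- Squared Minkowski distance to the apex `(R, c)` of a light cone. -/
def coneFun (R : ℝ) (c : Sp3) (p : ℝ × Sp3) : ℝ := (R - p.1) ^ 2 - ∑ i, (p.2 i - c i) ^ 2

/-- A smooth weight supported in the light cone with apex `(R, c)`. -/
def coneWeight (R : ℝ) (c : Sp3) (p : ℝ × Sp3) : ℝ := expNegInvGlue (coneFun R c p)

/-- Twice the Klein–Gordon energy density. -/
def energyDensity (m : ℝ) (F : ℝ × Sp3 → ℝ) (p : ℝ × Sp3) : ℝ :=
  dirDeriv timeDir F p ^ 2 + ∑ i, dirDeriv (spaceDir i) F p ^ 2 + m ^ 2 * F p ^ 2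

lemma contDiff_coneWeight (R : ℝ) (c : Sp3) {n : ℕ∞} : ContDiff ℝ n (coneWeight R c) := by
  refine expNegInvGlue.contDiff.comp ?_
  unfold coneFun
  fun_prop

lemma contDiff_energyDensity (m : ℝ) {F : ℝ × Sp3 → ℝ} (hF : ContDiff ℝ (⊤ : ℕ∞) F) {n : ℕ∞} :
    ContDiff ℝ n (energyDensity m F) := by
  have h := fun v => hF.dirDeriv (n := n) v
  have h0 : ContDiff ℝ n F := hF.of_le (by exact_mod_cast le_top)
  exact (((h _).pow 2).add (ContDiff.sum fun i _ => (h _).pow 2)).add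
    (contDiff_const.mul (h0.pow 2))

lemma energyDensity_nonneg (m : ℝ) (F : ℝ × Sp3 → ℝ) (p : ℝ × Sp3) : 0 ≤ energyDensity m F p := by
  unfold energyDensity
  positivity

lemma deriv_expNegInvGlue_nonneg (s : ℝ) : 0 ≤ deriv expNegInvGlue s :=
  expNegInvGlue.monotone.deriv_nonneg

lemma deriv_expNegInvGlue_of_nonpos {s : ℝ} (hs : s ≤ 0) : deriv expNegInvGlue s = 0 := by
  refine IsLocalMin.deriv_eq_zero (.of_forall fun x => ?_)
  rw [expNegInvGlue.zero_of_nonpos hs]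
  exact expNegInvGlue.nonneg x

lemma dirDeriv_coneWeight (R : ℝ) (c : Sp3) (p v : ℝ × Sp3) :
    dirDeriv v (coneWeight R c) p = deriv expNegInvGlue (coneFun R c p) *
      (-2 * (R - p.1) * v.1 - ∑ i, 2 * (p.2 i - c i) * v.2 i) := by
  have h1 : HasFDerivAt (fun p : ℝ × Sp3 => R - p.1) (-ContinuousLinearMap.fst ℝ ℝ Sp3) p :=
    (hasFDerivAt_fst (𝕜 := ℝ)).const_sub R
  have h2 : ∀ i, HasFDerivAt (fun p : ℝ × Sp3 => p.2 i - c i)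
      ((EuclideanSpace.proj i : Sp3 →L[ℝ] ℝ).comp (ContinuousLinearMap.snd ℝ ℝ Sp3)) p := fun i =>
    ((EuclideanSpace.proj i : Sp3 →L[ℝ] ℝ).comp
      (ContinuousLinearMap.snd ℝ ℝ Sp3)).hasFDerivAt.sub_const (c i)
  have h3 := (h1.pow 2).sub (HasFDerivAt.fun_sum fun i (_ : i ∈ Finset.univ) => (h2 i).pow 2)
  have h4 : HasDerivAt expNegInvGlue (deriv expNegInvGlue (coneFun R c p)) (coneFun R c p) :=
    ((expNegInvGlue.contDiff (n := 1)).differentiable (by simp) _).hasDerivAt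
  have h5 := (h4.comp_hasFDerivAt p (f := coneFun R c) h3).fderiv
  refine (congrArg (fun L => L v) h5).trans ?_
  simp

lemma two_mul_inner_le {u ρ w₀ w₁ w₂ y₀ y₁ y₂ : ℝ} (hρ : 0 < ρ)
    (h : y₀ ^ 2 + y₁ ^ 2 + y₂ ^ 2 ≤ ρ ^ 2) :
    2 * u * (w₀ * y₀ + w₁ * y₁ + w₂ * y₂) ≤ ρ * (u ^ 2 + (w₀ ^ 2 + w₁ ^ 2 + w₂ ^ 2)) := by
  have cs : (w₀ * y₀ + w₁ * y₁ + w₂ * y₂) ^ 2 ≤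
      (w₀ ^ 2 + w₁ ^ 2 + w₂ ^ 2) * (y₀ ^ 2 + y₁ ^ 2 + y₂ ^ 2) := by
    nlinarith [sq_nonneg (w₀ * y₁ - w₁ * y₀), sq_nonneg (w₀ * y₂ - w₂ * y₀),
      sq_nonneg (w₁ * y₂ - w₂ * y₁)]
  have h2 := mul_le_mul_of_nonneg_left h (by positivity : 0 ≤ w₀ ^ 2 + w₁ ^ 2 + w₂ ^ 2)
  refine le_of_mul_le_mul_left ?_ hρ
  nlinarith [sq_nonneg (ρ * u - (w₀ * y₀ + w₁ * y₁ + w₂ * y₂))]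

/-- Below the apex of the cone, the time derivative of the weighted energy density is bounded by
a spatial divergence. -/
lemma dirDeriv_weighted_energy_le {m : ℝ} {F : ℝ × Sp3 → ℝ} (hF : ContDiff ℝ (⊤ : ℕ∞) F)
    (hKG : ∀ p, dirDeriv timeDir (dirDeriv timeDir F) p =
      ∑ i, dirDeriv (spaceDir i) (dirDeriv (spaceDir i) F) p - m ^ 2 * F p)
    {R : ℝ} (c : Sp3) {p : ℝ × Sp3} (hp : p.1 < R) :
    dirDeriv timeDir (fun q => energyDensity m F q * coneWeight R c q) p ≤
      ∑ i, dirDeriv (spaceDir i) (fun q =>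
        2 * (dirDeriv timeDir F q * dirDeriv (spaceDir i) F q) * coneWeight R c q) p := by
  have hd : ∀ v, DifferentiableAt ℝ (dirDeriv v F) p := fun v =>
    (hF.dirDeriv (n := 1) v).differentiable (by simp) p
  have hFd : DifferentiableAt ℝ F p := hF.differentiable (by simp) p
  have hφ : DifferentiableAt ℝ (coneWeight R c) p :=
    (contDiff_coneWeight R c (n := 1)).differentiable (by simp) p
  have he : DifferentiableAt ℝ (energyDensity m F) p :=
    (contDiff_energyDensity m hF (n := 1)).differentiable (by simp) p
  have hsq : ∀ {f : ℝ × Sp3 → ℝ} (v), DifferentiableAt ℝ f p →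
      dirDeriv v (fun q => f q ^ 2) p = 2 * f p * dirDeriv v f p := by
    intro f v hf
    simp only [pow_two]
    rw [dirDeriv_mul hf hf]
    ring
  have hcm : ∀ {f : ℝ × Sp3 → ℝ} (a : ℝ) (v), DifferentiableAt ℝ f p →
      dirDeriv v (fun q => a * f q) p = a * dirDeriv v f p := by
    intro f a v hf
    simp [dirDeriv, fderiv_const_mul hf]
  have het : dirDeriv timeDir (energyDensity m F) p =
      2 * dirDeriv timeDir F p * dirDeriv timeDir (dirDeriv timeDir F) p +
      ∑ i, 2 * dirDeriv (spaceDir i) F p * dirDeriv (spaceDir i) (dirDeriv timeDir F) p +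
      m ^ 2 * (2 * F p * dirDeriv timeDir F p) := by
    unfold energyDensity
    simp only [Fin.sum_univ_three]
    rw [dirDeriv_add (by fun_prop) (by fun_prop), dirDeriv_add (by fun_prop) (by fun_prop),
      dirDeriv_add (by fun_prop) (by fun_prop), dirDeriv_add (by fun_prop) (by fun_prop),
      hcm _ _ (by fun_prop)]
    simp only [hsq _ (hd _), hsq _ hFd]
    simp only [dirDeriv_comm (v := timeDir) (w := spaceDir _) hF]
  rw [dirDeriv_mul he hφ, het, hKG]
  have hflux : ∀ i, dirDeriv (spaceDir i) (fun q =>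
      2 * (dirDeriv timeDir F q * dirDeriv (spaceDir i) F q) * coneWeight R c q) p =
      2 * (dirDeriv timeDir F p * dirDeriv (spaceDir i) F p) *
        dirDeriv (spaceDir i) (coneWeight R c) p +
      coneWeight R c p * (2 * (dirDeriv timeDir F p *
        dirDeriv (spaceDir i) (dirDeriv (spaceDir i) F) p +
        dirDeriv (spaceDir i) F p * dirDeriv (spaceDir i) (dirDeriv timeDir F) p)) := by
    intro i
    have h1 := hd timeDir
    have h2 := hd (spaceDir i)
    rw [dirDeriv_mul (by fun_prop) hφ, hcm _ _ (by fun_prop), dirDeriv_mul h1 h2]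
  simp only [hflux]
  have hwt : dirDeriv timeDir (coneWeight R c) p =
      deriv expNegInvGlue (coneFun R c p) * (-2 * (R - p.1)) := by
    simp [dirDeriv_coneWeight, timeDir]
  have hwx : ∀ i, dirDeriv (spaceDir i) (coneWeight R c) p =
      deriv expNegInvGlue (coneFun R c p) * (-2 * (p.2 i - c i)) := by
    intro i
    simp [dirDeriv_coneWeight, spaceDir, sdir]
  simp only [hwt, hwx, Fin.sum_univ_three, energyDensity]
  rcases le_or_gt (coneFun R c p) 0 with hq | hq
  · rw [deriv_expNegInvGlue_of_nonpos hq]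
    apply le_of_eq
    ring
  · have hD := deriv_expNegInvGlue_nonneg (coneFun R c p)
    simp only [coneFun, Fin.sum_univ_three] at hq
    have hin := two_mul_inner_le (u := dirDeriv timeDir F p) (w₀ := dirDeriv (spaceDir 0) F p)
      (w₁ := dirDeriv (spaceDir 1) F p) (w₂ := dirDeriv (spaceDir 2) F p)
      (y₀ := p.2 0 - c 0) (y₁ := p.2 1 - c 1) (y₂ := p.2 2 - c 2) (sub_pos.2 hp) (by linarith)
    have hin' := mul_le_mul_of_nonneg_left hin hD
    have hm : 0 ≤ deriv expNegInvGlue (coneFun R c p) * ((R - p.1) * (m ^ 2 * F p ^ 2)) :=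
      mul_nonneg hD (mul_nonneg (sub_pos.2 hp).le (by positivity))
    linear_combination 2 * hin' + 2 * hm

lemma coneWeight_eq_zero {R t : ℝ} {c x : Sp3} (ht : t ≤ R) (hx : x ∉ ball c (R - t)) :
    coneWeight R c (t, x) = 0 := by
  refine expNegInvGlue.zero_of_nonpos ?_
  have h1 : R - t ≤ dist x c := by simpa using hx
  have h2 : dist x c ^ 2 = ∑ i, (x i - c i) ^ 2 := by
    simp [EuclideanSpace.dist_sq_eq, Real.dist_eq]
  have h3 := pow_le_pow_left₀ (sub_nonneg.2 ht) h1 2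
  simp only [coneFun]
  linarith

/-- Energy estimate: a solution whose Cauchy data vanish on a ball vanishes on the axis of the
domain of dependence of that ball. -/
lemma eq_zero_of_cauchy_data_eq_zero {m : ℝ} {F : ℝ × Sp3 → ℝ} (hF : ContDiff ℝ (⊤ : ℕ∞) F)
    (hKG : ∀ p, dirDeriv timeDir (dirDeriv timeDir F) p =
      ∑ i, dirDeriv (spaceDir i) (dirDeriv (spaceDir i) F) p - m ^ 2 * F p)
    {R : ℝ} {c : Sp3} (h0 : ∀ x ∈ ball c R, F (0, x) = 0)
    (h1 : ∀ x ∈ ball c R, dirDeriv timeDir F (0, x) = 0) {T : ℝ} (hT : 0 ≤ T) (hTR : T < R) :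
    F (T, c) = 0 := by
  set G : ℝ × Sp3 → ℝ := fun q => energyDensity m F q * coneWeight R c q with hG
  have hGC : ContDiff ℝ 1 G := (contDiff_energyDensity m hF (n := 1)).mul
    (contDiff_coneWeight R c (n := 1))
  have hGnn : ∀ p, 0 ≤ G p := fun p =>
    mul_nonneg (energyDensity_nonneg m F p) (expNegInvGlue.nonneg _)
  have hWsupp : ∀ t ∈ Ioo (-1) R, ∀ x ∉ closedBall c (R + 1), coneWeight R c (t, x) = 0 := by
    intro t ht x hx
    refine coneWeight_eq_zero ht.2.le fun h => hx ?_
    exact ball_subset_closedBall (ball_subset_ball (by linarith [ht.1]) h)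
  have hGsupp : ∀ t ∈ Ioo (-1) R, ∀ x ∉ closedBall c (R + 1), G (t, x) = 0 := by
    intro t ht x hx
    simp [hG, hWsupp t ht x hx]
  have hslice : ∀ t, Continuous fun x => G (t, x) := fun t => hGC.continuous.comp (by fun_prop)
  have hE : ∀ t ∈ Ioo (-1) R, Integrable (fun x => dirDeriv timeDir G (t, x)) ∧
      HasDerivAt (fun s => ∫ x, G (s, x)) (∫ x, dirDeriv timeDir G (t, x)) t := fun t ht =>
    hasDerivAt_integral_of_bounded_support hGC hGsupp ht
  have hE' : ∀ t ∈ Ioo (-1) R, ∫ x, dirDeriv timeDir G (t, x) ≤ 0 := by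
    intro t ht
    set J : Fin 3 → ℝ × Sp3 → ℝ := fun i q =>
      2 * (dirDeriv timeDir F q * dirDeriv (spaceDir i) F q) * coneWeight R c q with hJ
    have hJC : ∀ i, ContDiff ℝ 1 (J i) := fun i =>
      (contDiff_const.mul ((hF.dirDeriv (n := 1) _).mul (hF.dirDeriv (n := 1) _))).mul
        (contDiff_coneWeight R c (n := 1))
    have hJs : ∀ i, ContDiff ℝ 1 fun x => J i (t, x) := fun i => (hJC i).comp (by fun_prop)
    have hJc : ∀ i, HasCompactSupport fun x => J i (t, x) := fun i =>
      HasCompactSupport.intro (isCompact_closedBall c (R + 1)) fun x hx => by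
        simp [hJ, hWsupp t ht x hx]
    have hJd : ∀ i x, dirDeriv (spaceDir i) (J i) (t, x) =
        fderiv ℝ (fun x => J i (t, x)) x (sdir i) := fun i x =>
      (fderiv_space_slice ((hJC i).differentiable (by simp) _) _).symm
    have hJi : ∀ i, Integrable fun x => dirDeriv (spaceDir i) (J i) (t, x) := by
      intro i
      simp only [hJd]
      exact (((hJs i).continuous_fderiv (by simp)).clm_apply
        continuous_const).integrable_of_hasCompactSupport ((hJc i).fderiv_apply (𝕜 := ℝ) _)
    have hJz : ∫ x, ∑ i, dirDeriv (spaceDir i) (J i) (t, x) = 0 := by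
      rw [integral_finsetSum _ fun i _ => hJi i]
      refine Finset.sum_eq_zero fun i _ => ?_
      simp only [hJd]
      exact integral_fderiv_eq_zero_of_hasCompactSupport (hJs i) (hJc i) _
    rw [← hJz]
    exact integral_mono (hE t ht).1 (integrable_finsetSum _ fun i _ => hJi i) fun x =>
      dirDeriv_weighted_energy_le hF hKG c ht.2
  have hanti : AntitoneOn (fun s => ∫ x, G (s, x)) (Icc 0 T) := by
    have hsub : Icc 0 T ⊆ Ioo (-1) R := fun s hs => ⟨by linarith [hs.1], by linarith [hs.2]⟩
    refine antitoneOn_of_deriv_nonpos (convex_Icc 0 T)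
      (fun s hs => (hE s (hsub hs)).2.continuousAt.continuousWithinAt)
      (fun s hs => (hE s (hsub (interior_subset hs))).2.differentiableAt.differentiableWithinAt)
      fun s hs => ?_
    rw [(hE s (hsub (interior_subset hs))).2.deriv]
    exact hE' s (hsub (interior_subset hs))
  have hG0 : ∀ x, G (0, x) = 0 := by
    intro x
    by_cases hx : x ∈ ball c R
    · have hw : ∀ i, dirDeriv (spaceDir i) F (0, x) = 0 := by
        intro i
        rw [spaceDir, ← fderiv_space_slice (hF.differentiable (by simp) _)]
        have hev : (fun y => F (0, y)) =ᶠ[𝓝 x] fun _ => 0 := by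
          filter_upwards [isOpen_ball.mem_nhds hx] with y hy using h0 y hy
        simp [hev.fderiv_eq]
      simp [hG, energyDensity, h0 x hx, h1 x hx, hw]
    · simp [hG, coneWeight_eq_zero (hT.trans hTR.le) (by simpa using hx : x ∉ ball c (R - 0))]
  have hu : ∀ t ∈ Icc 0 T, dirDeriv timeDir F (t, c) = 0 := by
    intro t ht
    have ht' : t ∈ Ioo (-1) R := ⟨by linarith [ht.1], by linarith [ht.2]⟩
    have hle : ∫ x, G (t, x) ≤ 0 := by
      simpa [hG0] using hanti ⟨le_rfl, hT⟩ ht ht.1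
    have hGt : G (t, c) = 0 := by
      by_contra hne
      refine hle.not_gt ((hslice t).integral_pos_of_hasCompactSupport_nonneg_nonzero
        (HasCompactSupport.intro (isCompact_closedBall c (R + 1)) (hGsupp t ht'))
        (fun x => hGnn _) hne)
    have hpos : 0 < coneWeight R c (t, c) := by
      refine expNegInvGlue.pos_of_pos ?_
      have : 0 < R - t := by linarith [ht.2]
      simpa [coneFun] using pow_pos this 2
    have he : energyDensity m F (t, c) = 0 := (mul_eq_zero.1 hGt).resolve_right hpos.ne'
    unfold energyDensity at he
    have hs : 0 ≤ ∑ i, dirDeriv (spaceDir i) F (t, c) ^ 2 :=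
      Finset.sum_nonneg fun i _ => sq_nonneg _
    have hm : 0 ≤ m ^ 2 * F (t, c) ^ 2 := by positivity
    exact pow_eq_zero_iff two_ne_zero |>.1 (le_antisymm (by linarith) (sq_nonneg _))
  have hd : ∀ t, HasDerivAt (fun r => F (r, c)) (dirDeriv timeDir F (t, c)) t := fun t =>
    hasDerivAt_time_slice (hF.differentiable (by simp) _)
  have hconst := constant_of_has_deriv_right_zero (a := 0) (b := T) (f := fun r => F (r, c))
    (fun t _ => (hd t).continuousAt.continuousWithinAt)
    (fun t ht => hu t ⟨ht.1, ht.2.le⟩ ▸ (hd t).hasDerivWithinAt) T ⟨hT, le_rfl⟩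
  exact hconst.trans (h0 c (mem_ball_self (hT.trans_lt hTR)))

/-- Finite propagation speed towards the future. -/
lemma eq_zero_of_lt_infEDist {m : ℝ} {ζ : ℝ → Sp3 → ℝ}
    (hsmooth : ContDiff ℝ (⊤ : ℕ∞) (fun p : ℝ × Sp3 => ζ p.1 p.2))
    (hKG : ∀ (t : ℝ) (x : Sp3),
      deriv (deriv (fun r => ζ r x)) t = lap (ζ t) x - m ^ 2 * ζ t x)
    {t : ℝ} (ht : 0 ≤ t) {x : Sp3}
    (hx : ENNReal.ofReal t < infEDist x (Function.support (fun x => ζ 0 x) ∪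
      Function.support (fun x => deriv (fun r => ζ r x) 0))) : ζ t x = 0 := by
  set F : ℝ × Sp3 → ℝ := fun p => ζ p.1 p.2 with hF
  have hFd : ∀ p, DifferentiableAt ℝ F p := hsmooth.differentiable (by simp)
  have hdd : ∀ v p, DifferentiableAt ℝ (dirDeriv v F) p := fun v =>
    (hsmooth.dirDeriv (n := 1) v).differentiable (by simp)
  have htime : ∀ s y, deriv (fun r => ζ r y) s = dirDeriv timeDir F (s, y) := fun s y =>
    (hasDerivAt_time_slice (hFd (s, y))).deriv
  have hspace : ∀ s y i, fderiv ℝ (ζ s) y (sdir i) = dirDeriv (spaceDir i) F (s, y) :=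
    fun s y i => fderiv_space_slice (hFd (s, y)) _
  obtain ⟨R, -, htR, hRx⟩ := ENNReal.lt_iff_exists_real_btwn.1 hx
  have htR' : t < R := (ENNReal.ofReal_lt_ofReal_iff_of_nonneg ht).1 htR
  have hball : ∀ y ∈ ball x R, y ∉ Function.support (fun x => ζ 0 x) ∪
      Function.support (fun x => deriv (fun r => ζ r x) 0) := by
    intro y hy hyK
    refine (hRx.trans_le (infEDist_le_edist_of_mem hyK)).not_ge ?_
    rw [edist_dist]
    exact ENNReal.ofReal_le_ofReal (by rw [dist_comm]; exact (mem_ball.1 hy).le)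
  refine eq_zero_of_cauchy_data_eq_zero (m := m) hsmooth ?_ (c := x) (R := R) ?_ ?_ ht htR'
  · rintro ⟨s, y⟩
    have h := hKG s y
    rw [funext fun s => htime s y, (hasDerivAt_time_slice (hdd timeDir (s, y))).deriv] at h
    rw [h]
    congr 1
    refine Finset.sum_congr rfl fun i _ => ?_
    simp only [pd2, hspace]
    exact fderiv_space_slice (hdd _ (s, y)) _
  · intro y hy
    by_contra h
    exact hball y hy (Or.inl h)
  · intro y hy
    by_contra h
    exact hball y hy (Or.inr (by simpa [htime] using h))

/-- Finite propagation speed for the Klein–Gordon equation: a smooth solution vanishes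
outside the causal shadow of the support of its Cauchy data. -/
theorem stmt_6 (m : ℝ) (ζ : ℝ → Sp3 → ℝ)
    (hsmooth : ContDiff ℝ (⊤ : ℕ∞) (fun p : ℝ × Sp3 => ζ p.1 p.2))
    (hKG : ∀ (t : ℝ) (x : Sp3),
      deriv (deriv (fun r => ζ r x)) t = lap (ζ t) x - m ^ 2 * ζ t x)
    (K : Set Sp3)
    (hK : K = Function.support (fun x => ζ 0 x) ∪
              Function.support (fun x => deriv (fun r => ζ r x) 0)) :
    ∀ (t : ℝ) (x : Sp3), ENNReal.ofReal |t| < EMetric.infEdist x K → ζ t x = 0 := by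
  subst hK
  intro t x hx
  rcases le_total 0 t with ht | ht
  · exact eq_zero_of_lt_infEDist hsmooth hKG ht (by rwa [abs_of_nonneg ht] at hx)
  · have hrev : ∀ (y : Sp3) (s : ℝ), deriv (fun r => ζ (-r) y) s = -deriv (fun r => ζ r y) (-s) :=
      fun y s => deriv_comp_neg (fun r => ζ r y) s
    have hsm : ContDiff ℝ (⊤ : ℕ∞) (fun p : ℝ × Sp3 => ζ (-p.1) p.2) :=
      hsmooth.comp (contDiff_fst.neg.prodMk contDiff_snd)
    have key := eq_zero_of_lt_infEDist (m := m) (ζ := fun s y => ζ (-s) y) hsm ?_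
      (neg_nonneg.2 ht) (x := x) ?_
    · simpa using key
    · intro s y
      rw [funext (hrev y), deriv.fun_neg, deriv_comp_neg (deriv fun r => ζ r y), neg_neg]
      exact hKG (-s) y
    · rw [abs_of_nonpos ht] at hx
      simp only [hrev, neg_zero, Function.support_fun_neg]
      exact hx

end
end

section
/- Let f be a complex-valued function, continuous on the closed upper half-plane {z ∈ ℂ : Im z ≥ 0}, holomorphic on the open upper half-plane, whose restriction to ℝ is continuously differentiable, which satisfies ∫_ℝ |f(ξ)|/(1+|ξ|) dξ < ∞ and f(z) → 0 as |z| → ∞ within the closed upper half-plane. Then for every E ∈ ℝ the dispersion relations hold: the principal-value integrals below exist and Re f(E) = (1/π) lim_{δ↓0} ∫_{|ξ−E|≥δ} Im f(ξ)/(ξ−E) dξ, while Im f(E) = −(1/π) lim_{δ↓0} ∫_{|ξ−E|≥δ} Re f(ξ)/(ξ−E) dξ. -/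
open Topology Filter MeasureTheory

/-- Integrals of `f` over upper half-circles converge when `f` converges along them uniformly in the
angle. -/
theorem tendsto_integral_upperArc {f : ℂ → ℂ} (hcont : ContinuousOn f {z : ℂ | 0 ≤ z.im})
    {E : ℝ} {c : ℂ} {l : Filter ℝ} {L : Filter ℂ}
    (hf : Tendsto f (L ⊓ 𝓟 {z : ℂ | 0 ≤ z.im}) (𝓝 c))
    (hL : Tendsto (fun p : ℝ × ℝ => (E : ℂ) + Complex.exp (Real.log p.1 + p.2 * Complex.I))
      (l ×ˢ 𝓟 (Set.Icc 0 Real.pi)) L) :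
    Tendsto (fun r : ℝ => ∫ θ in (0 : ℝ)..Real.pi,
      f (E + Complex.exp (Real.log r + θ * Complex.I))) l (𝓝 (Real.pi * c)) := by
  have him : ∀ (x : ℝ), ∀ θ ∈ Set.Icc 0 Real.pi,
      0 ≤ ((E : ℂ) + Complex.exp (x + θ * Complex.I)).im := by
    intro x θ hθ
    have := Real.sin_nonneg_of_mem_Icc hθ
    simp [Complex.exp_im]
    positivity
  have hlim : Tendsto (fun p : ℝ × ℝ => f ((E : ℂ) + Complex.exp (Real.log p.1 + p.2 * Complex.I)))
      (l ×ˢ 𝓟 (Set.Icc 0 Real.pi)) (𝓝 c) := by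
    refine hf.comp (tendsto_inf.2 ⟨hL, tendsto_principal.2 ?_⟩)
    have : ∀ᶠ p : ℝ × ℝ in l ×ˢ 𝓟 (Set.Icc 0 Real.pi), p.2 ∈ Set.Icc 0 Real.pi :=
      tendsto_snd.eventually (eventually_principal.2 fun _ h => h)
    filter_upwards [this] with p hp using him _ _ hp
  have hunif : TendstoUniformlyOn
      (fun (r θ : ℝ) => f ((E : ℂ) + Complex.exp (Real.log r + θ * Complex.I)))
      (fun _ => c) l (Set.Icc 0 Real.pi) := by
    rw [tendstoUniformlyOn_iff_tendstoUniformlyOnFilter, tendstoUniformlyOnFilter_iff_tendsto]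
    exact ((tendsto_const_nhds (x := c)).prodMk_nhds hlim).mono_right (nhds_le_uniformity c)
  rw [Metric.tendsto_nhds]
  intro ε hε
  filter_upwards [Metric.tendstoUniformlyOn_iff.1 hunif (ε / 4) (by positivity)] with r hr
  have hci : IntervalIntegrable (fun θ : ℝ => f ((E : ℂ) + Complex.exp (Real.log r + θ * Complex.I)))
      volume 0 Real.pi := by
    apply ContinuousOn.intervalIntegrable
    rw [Set.uIcc_of_le Real.pi_pos.le]
    exact hcont.comp (by fun_prop) fun θ hθ => him _ _ hθ
  have hcon : (Real.pi : ℂ) * c = ∫ θ in (0 : ℝ)..Real.pi, c := by simp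
  rw [dist_eq_norm, hcon, ← intervalIntegral.integral_sub hci (by simp)]
  have := intervalIntegral.norm_integral_le_of_norm_le_const (a := 0) (b := Real.pi) (C := ε / 4)
    (f := fun θ : ℝ => f ((E : ℂ) + Complex.exp (Real.log r + θ * Complex.I)) - c) (by
      intro θ hθ
      rw [Set.uIoc_of_le Real.pi_pos.le] at hθ
      have := hr θ (Set.Ioc_subset_Icc_self hθ)
      rw [dist_comm, dist_eq_norm] at this
      exact this.le)
  refine this.trans_lt ?_
  rw [sub_zero, abs_of_pos Real.pi_pos]
  nlinarith [Real.pi_lt_four]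

theorem norm_exp_log_add_mul_I {r : ℝ} (hr : 0 < r) (θ : ℝ) :
    ‖Complex.exp (Real.log r + θ * Complex.I)‖ = r := by
  simp [Complex.norm_exp, Real.exp_log hr]

theorem tendsto_integral_upperArc_zero {f : ℂ → ℂ} (hcont : ContinuousOn f {z : ℂ | 0 ≤ z.im})
    (E : ℝ) :
    Tendsto (fun r : ℝ => ∫ θ in (0 : ℝ)..Real.pi,
      f (E + Complex.exp (Real.log r + θ * Complex.I))) (𝓝[>] 0) (𝓝 (Real.pi * f E)) := by
  have hpos : ∀ᶠ r : ℝ in 𝓝[>] 0, 0 < r := self_mem_nhdsWithin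
  refine tendsto_integral_upperArc hcont (L := 𝓝 (E : ℂ))
    (hcont E (by simp)) ?_
  rw [tendsto_iff_norm_sub_tendsto_zero]
  have h : Tendsto (fun p : ℝ × ℝ => p.1) (𝓝[>] 0 ×ˢ 𝓟 (Set.Icc 0 Real.pi)) (𝓝 0) :=
    (tendsto_fst (f := 𝓝[>] (0 : ℝ))).mono_right nhdsWithin_le_nhds
  refine h.congr' ?_
  filter_upwards [tendsto_fst.eventually hpos] with p hp
  rw [add_sub_cancel_left, norm_exp_log_add_mul_I hp]

theorem tendsto_integral_upperArc_atTop {f : ℂ → ℂ} (hcont : ContinuousOn f {z : ℂ | 0 ≤ z.im})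
    (hdecay : Tendsto f (Bornology.cobounded ℂ ⊓ 𝓟 {z : ℂ | 0 ≤ z.im}) (𝓝 0)) (E : ℝ) :
    Tendsto (fun r : ℝ => ∫ θ in (0 : ℝ)..Real.pi,
      f (E + Complex.exp (Real.log r + θ * Complex.I))) atTop (𝓝 0) := by
  rw [← mul_zero (Real.pi : ℂ)]
  refine tendsto_integral_upperArc hcont hdecay ?_
  rw [← tendsto_norm_atTop_iff_cobounded]
  have h : Tendsto (fun p : ℝ × ℝ => p.1 - |E|) (atTop ×ˢ 𝓟 (Set.Icc 0 Real.pi)) atTop :=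
    tendsto_atTop_add_const_right _ _ tendsto_fst
  refine tendsto_atTop_mono' _ ?_ h
  filter_upwards [tendsto_fst.eventually (eventually_gt_atTop 0)] with p hp
  have h1 := norm_sub_le_norm_add (Complex.exp (Real.log p.1 + p.2 * Complex.I)) (E : ℂ)
  rw [norm_exp_log_add_mul_I hp, Complex.norm_real, Real.norm_eq_abs] at h1
  rwa [add_comm (E : ℂ)]

theorem integral_exp_sub_integral_exp {f : ℂ → ℂ} (hcont : ContinuousOn f {z : ℂ | 0 ≤ z.im})
    (hholo : DifferentiableOn ℂ f {z : ℂ | 0 < z.im}) (E a b : ℝ) :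
    (∫ x in a..b, f (E + Complex.exp x)) - (∫ x in a..b, f (E - Complex.exp x)) =
      Complex.I * ((∫ θ in (0 : ℝ)..Real.pi, f (E + Complex.exp (a + θ * Complex.I))) -
        ∫ θ in (0 : ℝ)..Real.pi, f (E + Complex.exp (b + θ * Complex.I))) := by
  have h := Complex.integral_boundary_rect_eq_zero_of_continuousOn_of_differentiableOn
    (fun s => f (E + Complex.exp s)) a (b + Real.pi * Complex.I) (by
      refine hcont.comp (by fun_prop) fun s hs => ?_
      have hs2 : s.im ∈ Set.Icc 0 Real.pi := by
        simpa [Set.uIcc_of_le Real.pi_pos.le] using hs.2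
      have := Real.sin_nonneg_of_mem_Icc hs2
      simp [Complex.exp_im]
      positivity) (by
      refine hholo.comp (by fun_prop) fun s hs => ?_
      have hs2 : s.im ∈ Set.Ioo 0 Real.pi := by
        simpa [Real.pi_pos.le] using hs.2
      have := Real.sin_pos_of_mem_Ioo hs2
      simp [Complex.exp_im]
      positivity)
  simp [Complex.exp_add, ← sub_eq_add_neg] at h
  simp only [Complex.exp_add]
  linear_combination h

theorem integrableOn_div_sub {f : ℝ → ℂ} (hf : Continuous f)
    (hint : Integrable (fun ξ : ℝ => ‖f ξ‖ / (1 + |ξ|))) (E : ℝ) {δ : ℝ} (hδ : 0 < δ) :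
    IntegrableOn (fun ξ : ℝ => f ξ / (ξ - E)) {ξ : ℝ | δ ≤ |ξ - E|} := by
  have hS : MeasurableSet {ξ : ℝ | δ ≤ |ξ - E|} :=
    (isClosed_le continuous_const (by fun_prop)).measurableSet
  refine Integrable.mono' (hint.const_mul ((1 + |E|) / δ + 1)).integrableOn ?_ ?_
  · refine (hf.measurable.div ?_).aestronglyMeasurable
    fun_prop
  · filter_upwards [ae_restrict_mem hS] with ξ (hξ : δ ≤ |ξ - E|)
    have hpos : 0 < |ξ - E| := hδ.trans_le hξ
    have h1 : ‖(ξ : ℂ) - E‖ = |ξ - E| := by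
      rw [← Complex.ofReal_sub, Complex.norm_real, Real.norm_eq_abs]
    rw [norm_div, h1, ← mul_div_assoc, div_le_div_iff₀ hpos (by positivity)]
    have h2 : |ξ| ≤ |ξ - E| + |E| := by
      simpa using abs_add_le (ξ - E) E
    have h3 : 1 + |E| ≤ (1 + |E|) / δ * |ξ - E| := by
      rw [div_mul_eq_mul_div, le_div_iff₀ hδ]
      gcongr
    have h4 : 1 + |ξ| ≤ ((1 + |E|) / δ + 1) * |ξ - E| := by linarith
    calc ‖f ξ‖ * (1 + |ξ|) ≤ ‖f ξ‖ * (((1 + |E|) / δ + 1) * |ξ - E|) := by gcongr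
      _ = _ := by ring

theorem integral_comp_add_exp {f : ℝ → ℂ} (hf : Continuous f) (E : ℝ) {δ R : ℝ} (hδ : 0 < δ)
    (hR : 0 < R) :
    ∫ x in Real.log δ..Real.log R, f (E + Real.exp x) =
      ∫ ξ in (E + δ)..(E + R), f ξ / (ξ - E) := by
  have := intervalIntegral.integral_deriv_smul_comp' (a := Real.log δ) (b := Real.log R)
    (f := fun x => E + Real.exp x) (f' := Real.exp) (g := fun ξ : ℝ => f ξ / (ξ - E))
    (fun x _ => (Real.hasDerivAt_exp x).const_add E) Real.continuous_exp.continuousOn (by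
      refine ContinuousOn.div hf.continuousOn (by fun_prop) ?_
      rintro _ ⟨x, -, rfl⟩
      simp)
  simp only [Real.exp_log hδ, Real.exp_log hR] at this
  rw [← this]
  congr 1 with x
  simp [mul_div_cancel₀]

theorem integral_comp_sub_exp {f : ℝ → ℂ} (hf : Continuous f) (E : ℝ) {δ R : ℝ} (hδ : 0 < δ)
    (hR : 0 < R) :
    ∫ x in Real.log δ..Real.log R, f (E - Real.exp x) =
      -∫ ξ in (E - R)..(E - δ), f ξ / (ξ - E) := by
  have := intervalIntegral.integral_deriv_smul_comp' (a := Real.log δ) (b := Real.log R)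
    (f := fun x => E - Real.exp x) (f' := fun x => -Real.exp x)
    (g := fun ξ : ℝ => f ξ / (ξ - E))
    (fun x _ => (Real.hasDerivAt_exp x).const_sub E) (by fun_prop) (by
      refine ContinuousOn.div hf.continuousOn (by fun_prop) ?_
      rintro _ ⟨x, -, rfl⟩
      simp)
  simp only [Real.exp_log hδ, Real.exp_log hR] at this
  rw [← intervalIntegral.integral_symm, ← this]
  congr 1 with x
  simp
  field_simp

theorem setIntegral_div_sub_eq {f : ℂ → ℂ} (hcont : ContinuousOn f {z : ℂ | 0 ≤ z.im})
    (hholo : DifferentiableOn ℂ f {z : ℂ | 0 < z.im})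
    (hint : Integrable (fun ξ : ℝ => ‖f (ξ : ℂ)‖ / (1 + |ξ|)))
    (hdecay : Tendsto f (Bornology.cobounded ℂ ⊓ 𝓟 {z : ℂ | 0 ≤ z.im}) (𝓝 0))
    (E : ℝ) {δ : ℝ} (hδ : 0 < δ) :
    ∫ ξ in {ξ : ℝ | δ ≤ |ξ - E|}, f ξ / (ξ - E) =
      Complex.I * ∫ θ in (0 : ℝ)..Real.pi,
        f (E + Complex.exp (Real.log δ + θ * Complex.I)) := by
  have hf : Continuous fun ξ : ℝ => f ξ :=
    hcont.comp_continuous Complex.continuous_ofReal fun _ => by simp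
  have hi := integrableOn_div_sub hf hint E hδ
  have hS : {ξ : ℝ | δ ≤ |ξ - E|} = Set.Iic (E - δ) ∪ Set.Ici (E + δ) := by
    ext ξ
    simp only [Set.mem_ofPred_eq, Set.mem_union, Set.mem_Iic, Set.mem_Ici, le_abs]
    constructor <;> (rintro (h | h) <;> first | (left; linarith) | (right; linarith))
  rw [hS] at hi ⊢
  have hiL := hi.mono_set Set.subset_union_left
  have hiR := hi.mono_set Set.subset_union_right
  rw [setIntegral_union (Set.disjoint_left.2 fun x hx hx' => by
    simp only [Set.mem_Iic, Set.mem_Ici] at hx hx'; linarith) measurableSet_Ici hiL hiR,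
    integral_Ici_eq_integral_Ioi]
  have hL := intervalIntegral_tendsto_integral_Iic (l := atTop) (a := fun R : ℝ => E - R) (E - δ)
    hiL (tendsto_atBot_add_const_left _ _ tendsto_neg_atTop_atBot)
  have hR := intervalIntegral_tendsto_integral_Ioi (l := atTop) (b := fun R : ℝ => E + R) (E + δ)
    (hiR.mono_set Set.Ioi_subset_Ici_self) (tendsto_atTop_add_const_left _ _ tendsto_id)
  have hA := ((tendsto_integral_upperArc_atTop hcont hdecay E).const_sub
    (∫ θ in (0 : ℝ)..Real.pi, f (E + Complex.exp (Real.log δ + θ * Complex.I)))).const_mul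
      Complex.I
  rw [sub_zero] at hA
  refine tendsto_nhds_unique (hL.add hR) (hA.congr' ?_)
  filter_upwards [eventually_gt_atTop 0] with R hR
  have h1 := integral_comp_add_exp hf E hδ hR
  have h2 := integral_comp_sub_exp hf E hδ hR
  rw [← integral_exp_sub_integral_exp hcont hholo]
  push_cast at h1 h2
  rw [h1, h2]
  ring

/-- Dispersion relations: the real and imaginary parts on the real axis of a function
holomorphic on the upper half-plane, with integrable decay, are mutual Hilbert
transforms (principal-value integrals). -/
theorem stmt_13 (f : ℂ → ℂ)
    (hcont : ContinuousOn f {z : ℂ | 0 ≤ z.im})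
    (hholo : DifferentiableOn ℂ f {z : ℂ | 0 < z.im})
    (hC1 : ContDiff ℝ 1 (fun ξ : ℝ => f (ξ : ℂ)))
    (hint : Integrable (fun ξ : ℝ => ‖f (ξ : ℂ)‖ / (1 + |ξ|)))
    (hdecay : Tendsto f (Bornology.cobounded ℂ ⊓ Filter.principal {z : ℂ | 0 ≤ z.im})
      (𝓝 0)) :
    ∀ E : ℝ,
      Tendsto (fun δ : ℝ => ∫ ξ in {ξ : ℝ | δ ≤ |ξ - E|}, (f (ξ : ℂ)).im / (ξ - E))
        (𝓝[>] (0 : ℝ)) (𝓝 (Real.pi * (f (E : ℂ)).re))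
      ∧ Tendsto (fun δ : ℝ => ∫ ξ in {ξ : ℝ | δ ≤ |ξ - E|}, (f (ξ : ℂ)).re / (ξ - E))
        (𝓝[>] (0 : ℝ)) (𝓝 (-(Real.pi * (f (E : ℂ)).im))) := by
  intro E
  have hlim : Tendsto (fun δ : ℝ => ∫ ξ in {ξ : ℝ | δ ≤ |ξ - E|}, f ξ / (ξ - E))
      (𝓝[>] (0 : ℝ)) (𝓝 (Complex.I * (Real.pi * f E))) := by
    refine ((tendsto_integral_upperArc_zero hcont E).const_mul Complex.I).congr' ?_
    filter_upwards [self_mem_nhdsWithin] with δ hδ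
    exact (setIntegral_div_sub_eq hcont hholo hint hdecay E hδ).symm
  constructor
  · have h := (Complex.continuous_im.tendsto _).comp hlim
    have hval : (Complex.I * (Real.pi * f E)).im = Real.pi * (f E).re := by simp
    rw [hval] at h
    refine h.congr' ?_
    filter_upwards [self_mem_nhdsWithin] with δ hδ
    refine (integral_im (integrableOn_div_sub hC1.continuous hint E hδ)).symm.trans ?_
    simp [← Complex.ofReal_sub]
  · have h := (Complex.continuous_re.tendsto _).comp hlim
    have hval : (Complex.I * (Real.pi * f E)).re = -(Real.pi * (f E).im) := by simp
    rw [hval] at h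
    refine h.congr' ?_
    filter_upwards [self_mem_nhdsWithin] with δ hδ
    refine (integral_re (integrableOn_div_sub hC1.continuous hint E hδ)).symm.trans ?_
    simp [← Complex.ofReal_sub]
end

section
/- Let f be a complex-valued function, continuous on the closed upper half-plane {z ∈ ℂ : Im z ≥ 0}, holomorphic on the open upper half-plane, whose restriction to ℝ is twice continuously differentiable, such that the derivative f' extends continuously to the closed upper half-plane, ∫_ℝ |f'(ξ)|/(1+|ξ|) dξ < ∞, and f'(z) → 0 as |z| → ∞ within the closed upper half-plane. Then for every E ∈ ℝ the once-subtracted dispersion relations hold: Re f(E) = Re f(0) + (1/π) lim_{δ↓0} ∫_{|ξ−E|≥δ, |ξ|≥δ} Im f(ξ) (1/(ξ−E) − 1/ξ) dξ, and Im f(E) = Im f(0) − (1/π) lim_{δ↓0} ∫_{|ξ−E|≥δ, |ξ|≥δ} Re f(ξ) (1/(ξ−E) − 1/ξ) dξ (in particular both limits exist). -/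
open Topology Filter MeasureTheory

/-- A function continuous on the closed upper half-plane whose derivative extends continuously
to the closure is differentiable up to the boundary. -/
lemma hasDerivWithinAt_closed_upper {f g : ℂ → ℂ}
    (hcont : ContinuousOn f {z : ℂ | 0 ≤ z.im})
    (hgcont : ContinuousOn g {z : ℂ | 0 ≤ z.im})
    (hgderiv : ∀ z : ℂ, 0 < z.im → HasDerivAt f (g z) z) {x : ℂ} (hx : 0 ≤ x.im) :
    HasDerivWithinAt f (g x) {z : ℂ | 0 ≤ z.im} x := by
  have hcl : closure {z : ℂ | 0 < z.im} = {z : ℂ | 0 ≤ z.im} := Complex.closure_setOfPred_lt_im 0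
  have hopen : IsOpen {z : ℂ | 0 < z.im} := isOpen_lt continuous_const Complex.continuous_im
  have hsub : {z : ℂ | 0 < z.im} ⊆ {z : ℂ | 0 ≤ z.im} := fun z (hz : 0 < z.im) => show 0 ≤ z.im from hz.le
  have key : HasFDerivWithinAt f
      ((ContinuousLinearMap.toSpanSingleton ℂ (g x)).restrictScalars ℝ)
      (closure {z : ℂ | 0 < z.im}) x := by
    refine hasFDerivWithinAt_closure_of_tendsto_fderiv ?_ (convex_halfSpace_im_gt 0) hopen ?_ ?_
    · intro z hz
      exact ((hgderiv z hz).differentiableAt.restrictScalars ℝ).differentiableWithinAt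
    · intro y hy
      rw [hcl] at hy
      exact (hcont y hy).mono hsub
    · have h1 : Tendsto g (𝓝[{z : ℂ | 0 < z.im}] x) (𝓝 (g x)) := (hgcont x hx).mono hsub
      have h2 : Continuous fun w : ℂ =>
          (ContinuousLinearMap.toSpanSingleton ℂ w).restrictScalars ℝ := by
        have : Continuous fun w : ℂ => ContinuousLinearMap.toSpanSingleton ℂ w := by
          exact (ContinuousLinearMap.toSpanSingletonCLE (𝕜 := ℂ) (E := ℂ)).continuous
        exact (ContinuousLinearMap.continuous_restrictScalars ℝ).comp this
      refine ((h2.tendsto _).comp h1).congr' ?_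
      filter_upwards [self_mem_nhdsWithin] with z hz
      exact ((hgderiv z hz).hasFDerivAt.restrictScalars ℝ).fderiv.symm
  rw [hcl] at key
  simpa using (key.of_restrictScalars ℝ rfl).hasDerivWithinAt

/-- A function on the closed upper half-plane whose derivative vanishes at infinity grows
sublinearly. -/
lemma tendsto_div_id_of_deriv_tendsto_zero {f g : ℂ → ℂ}
    (hderiv : ∀ z : ℂ, 0 ≤ z.im → HasDerivWithinAt f (g z) {z : ℂ | 0 ≤ z.im} z)
    (hdecay : Tendsto g (Bornology.cobounded ℂ ⊓ 𝓟 {z : ℂ | 0 ≤ z.im}) (𝓝 0)) :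
    Tendsto (fun z => f z / z) (Bornology.cobounded ℂ ⊓ 𝓟 {z : ℂ | 0 ≤ z.im}) (𝓝 0) := by
  rw [Metric.tendsto_nhds]
  intro ε hε
  have h1 := Metric.tendsto_nhds.1 hdecay (ε / 2) (by positivity)
  rw [eventually_inf_principal, ← comap_norm_atTop, eventually_comap] at h1
  obtain ⟨M₀, hM₀⟩ := eventually_atTop.1 h1
  set M := max M₀ 1 with hM
  have hMpos : 0 < M := lt_of_lt_of_le one_pos (le_max_right _ _)
  have hK : IsCompact ({z : ℂ | 0 ≤ z.im} ∩ Metric.closedBall 0 M) :=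
    (isCompact_closedBall 0 M).inter_left (isClosed_le continuous_const Complex.continuous_im)
  obtain ⟨K, hK⟩ := hK.exists_bound_of_continuousOn (f := f)
    (fun z hz => ((hderiv z hz.1).continuousWithinAt).mono Set.inter_subset_left)
  rw [eventually_inf_principal, ← comap_norm_atTop, eventually_comap]
  filter_upwards [eventually_gt_atTop (max M (2 * K / ε))] with r hr z hz hzim
  have hrM : M < r := lt_of_le_of_lt (le_max_left _ _) hr
  have hrK : 2 * K / ε < r := lt_of_le_of_lt (le_max_right _ _) hr
  have hrpos : 0 < r := hMpos.trans hrM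
  have hz' : ∀ t : ℝ, 0 ≤ t → ‖(t : ℂ) * z‖ = t * r := by
    intro t ht
    rw [norm_mul, hz, Complex.norm_real, Real.norm_of_nonneg ht]
  have him : ∀ t : ℝ, 0 ≤ t → 0 ≤ ((t : ℂ) * z).im := by
    intro t ht
    rw [Complex.im_ofReal_mul]
    exact mul_nonneg ht hzim
  set w : ℂ := ((M / r : ℝ) : ℂ) * z with hw
  have hseg : ∀ y ∈ segment ℝ w z, 0 ≤ y.im ∧ M ≤ ‖y‖ ∧ ‖z - w‖ ≤ r := by
    rintro y ⟨a, b, ha, hb, hab, rfl⟩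
    have hMr : 0 < M / r := by positivity
    have e : a • w + b • z = ((a * (M / r) + b : ℝ) : ℂ) * z := by
      simp only [hw, Complex.real_smul]; push_cast; ring
    have hnn : 0 ≤ a * (M / r) + b := by positivity
    rw [e]
    refine ⟨him _ hnn, ?_, ?_⟩
    · rw [hz' _ hnn, add_mul, mul_assoc, div_mul_cancel₀ _ hrpos.ne']
      nlinarith
    · have e2 : z - w = ((1 - M / r : ℝ) : ℂ) * z := by
        simp only [hw]; push_cast; ring
      have : M / r ≤ 1 := (div_le_one hrpos).2 hrM.le
      rw [e2, hz' _ (by linarith)]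
      nlinarith
  have hmv : ‖f z - f w‖ ≤ ε / 2 * ‖z - w‖ := by
    refine Convex.norm_image_sub_le_of_norm_hasDerivWithin_le (f' := g) (s := segment ℝ w z)
      (fun y hy => (hderiv y (hseg y hy).1).mono fun u hu => (hseg u hu).1) ?_
      (convex_segment _ _) (left_mem_segment _ _ _) (right_mem_segment _ _ _)
    intro y hy
    have := hM₀ ‖y‖ ((le_max_left _ _).trans (hseg y hy).2.1) y rfl (hseg y hy).1
    rw [dist_zero_right] at this
    exact this.le
  have hfw : ‖f w‖ ≤ K := by
    refine hK w ⟨him _ (by positivity), ?_⟩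
    rw [mem_closedBall_zero_iff, hz' _ (by positivity), div_mul_cancel₀ _ hrpos.ne']
  have hzw := (hseg z (right_mem_segment _ _ _)).2.2
  have hfz : ‖f z‖ ≤ K + ε / 2 * r := by
    calc ‖f z‖ = ‖f w + (f z - f w)‖ := by ring_nf
      _ ≤ ‖f w‖ + ‖f z - f w‖ := norm_add_le _ _
      _ ≤ K + ε / 2 * r := by nlinarith
  rw [dist_zero_right, norm_div, hz, div_lt_iff₀ hrpos]
  rw [div_lt_iff₀ hε] at hrK
  linarith

/-- The integral over `[-R, R]` of a function holomorphic in the upper half-plane which is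
`o(1 / z)` at infinity tends to zero. -/
lemma tendsto_integral_real_zero_of_holomorphic {B : ℂ → ℂ}
    (hc : ContinuousOn B {z : ℂ | 0 ≤ z.im})
    (hd : DifferentiableOn ℂ B {z : ℂ | 0 < z.im})
    (hz : Tendsto (fun z => z * B z) (Bornology.cobounded ℂ ⊓ 𝓟 {z : ℂ | 0 ≤ z.im}) (𝓝 0)) :
    Tendsto (fun R : ℝ => ∫ x in (-R)..R, B x) atTop (𝓝 0) := by
  rw [Metric.tendsto_nhds]
  intro ε hε
  have h1 := Metric.tendsto_nhds.1 hz (ε / 5) (by positivity)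
  rw [eventually_inf_principal, ← comap_norm_atTop, eventually_comap] at h1
  obtain ⟨M, hM⟩ := eventually_atTop.1 h1
  filter_upwards [eventually_gt_atTop (max M 0)] with R hR
  have hRM : M < R := lt_of_le_of_lt (le_max_left _ _) hR
  have hR0 : 0 < R := lt_of_le_of_lt (le_max_right _ _) hR
  have hb : ∀ z : ℂ, 0 ≤ z.im → R ≤ ‖z‖ → ‖B z‖ ≤ ε / 5 / R := by
    intro z hzim hzR
    have h2 := hM ‖z‖ (hRM.le.trans hzR) z rfl hzim
    rw [dist_zero_right, norm_mul] at h2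
    rw [le_div_iff₀ hR0]
    nlinarith [norm_nonneg (B z)]
  have hcauchy := Complex.integral_boundary_rect_eq_zero_of_continuousOn_of_differentiableOn B
    (-R : ℝ) (R + R * Complex.I)
    (hc.mono (by
      intro z hz
      have := hz.2
      simp only [Set.mem_preimage, Complex.ofReal_im, Complex.add_im, Complex.mul_im,
        Complex.ofReal_re, Complex.I_im, mul_one, Complex.I_re, mul_zero, add_zero, zero_add,
        Set.uIcc_of_le hR0.le] at this
      exact this.1))
    (hd.mono (by
      intro z hz
      have := hz.2
      simp only [Set.mem_preimage, Complex.ofReal_im, Complex.add_im, Complex.mul_im,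
        Complex.ofReal_re, Complex.I_im, mul_one, Complex.I_re, mul_zero, add_zero, zero_add,
        min_eq_left hR0.le] at this
      exact this.1))
  simp only [Complex.ofReal_im, Complex.add_im, Complex.mul_im, Complex.add_re, Complex.mul_re,
        Complex.ofReal_re, Complex.I_im, mul_one, Complex.I_re, mul_zero, add_zero, zero_add,
        Complex.ofReal_zero, zero_mul, sub_self] at hcauchy
  have htop : ‖∫ x in (-R)..R, B (x + R * Complex.I)‖ ≤ ε / 5 / R * |R - -R| := by
    refine intervalIntegral.norm_integral_le_of_norm_le_const fun x _ => hb _ (by simp [hR0.le]) ?_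
    refine le_trans ?_ (Complex.abs_im_le_norm _)
    simp [abs_of_pos hR0]
  have hside : ∀ s : ℝ, |s| = R →
      ‖∫ y in (0 : ℝ)..R, B (s + y * Complex.I)‖ ≤ ε / 5 / R * |R - 0| := by
    intro s hs
    refine intervalIntegral.norm_integral_le_of_norm_le_const fun y hy => hb _ ?_ ?_
    · rw [Set.uIoc_of_le hR0.le] at hy
      simpa using hy.1.le
    · refine le_trans ?_ (Complex.abs_re_le_norm _)
      simp [hs]
  have hs1 := hside R (abs_of_pos hR0)
  have hs2 := hside (-R) (by rw [abs_neg, abs_of_pos hR0])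
  have e1 : ε / 5 / R * |R - -R| = 2 * (ε / 5) := by
    rw [abs_of_pos (by linarith)]; field_simp; ring
  have e2 : ε / 5 / R * |R - 0| = ε / 5 := by
    rw [sub_zero, abs_of_pos hR0]; field_simp
  rw [e1] at htop
  rw [e2] at hs1 hs2
  rw [dist_zero_right]
  have e3 : (∫ x in (-R)..R, B x) = (∫ x in (-R)..R, B (x + R * Complex.I))
      - Complex.I • (∫ y in (0 : ℝ)..R, B (R + y * Complex.I))
      + Complex.I • (∫ y in (0 : ℝ)..R, B ((-R : ℝ) + y * Complex.I)) := by
    linear_combination hcauchy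
  rw [e3]
  calc _ ≤ ‖(∫ x in (-R)..R, B (x + R * Complex.I))‖
      + ‖Complex.I • (∫ y in (0 : ℝ)..R, B (R + y * Complex.I))‖
      + ‖Complex.I • (∫ y in (0 : ℝ)..R, B ((-R : ℝ) + y * Complex.I))‖ :=
        (norm_add_le _ _).trans (by gcongr; exact norm_sub_le _ _)
    _ < ε := by
      rw [norm_smul, norm_smul, Complex.norm_I, one_mul, one_mul]
      linarith

/-- If `‖u'‖ / (1 + |x|)` is integrable then so is `‖u‖ / (1 + |x|) ^ 2` on the positive half
line. -/
lemma integrableOn_Ioi_norm_div_sq {u v : ℝ → ℂ} (hu : ∀ x, HasDerivAt u (v x) x)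
    (hv : Continuous v) (hint : Integrable fun x : ℝ => ‖v x‖ / (1 + |x|)) :
    IntegrableOn (fun x : ℝ => ‖u x‖ / (1 + |x|) ^ 2) (Set.Ioi 0) := by
  have huc : Continuous u := continuous_iff_continuousAt.2 fun x => (hu x).continuousAt
  have hden : ∀ x : ℝ, (1 + |x|) ≠ 0 := fun x => by positivity
  have hcont : Continuous fun x : ℝ => ‖u x‖ / (1 + |x|) ^ 2 :=
    huc.norm.div (by fun_prop) fun x => pow_ne_zero _ (hden x)
  have hwc : Continuous fun x : ℝ => ‖v x‖ / (1 + |x|) := hv.norm.div (by fun_prop) hden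
  set G : ℝ → ℝ := fun x => ‖u 0‖ + ∫ s in (0 : ℝ)..x, ‖v s‖ with hG
  have hGd : ∀ x, HasDerivAt G ‖v x‖ x := fun x =>
    (hv.norm.integral_hasStrictDerivAt 0 x).hasDerivAt.const_add _
  have hGc : Continuous G := continuous_iff_continuousAt.2 fun x => (hGd x).continuousAt
  have huG : ∀ x, 0 ≤ x → ‖u x‖ ≤ G x := by
    intro x hx
    have h1 : ∫ s in (0 : ℝ)..x, v s = u x - u 0 :=
      intervalIntegral.integral_eq_sub_of_hasDerivAt (fun s _ => hu s)
        (hv.intervalIntegrable _ _)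
    have h2 := intervalIntegral.norm_integral_le_integral_norm (f := v) (μ := volume) hx
    rw [h1] at h2
    have h3 := norm_sub_norm_le (u x) (u 0)
    simp only [hG]
    linarith
  refine integrableOn_Ioi_of_intervalIntegral_norm_bounded (l := atTop) (b := id)
    ((∫ x : ℝ, ‖v x‖ / (1 + |x|)) + ‖u 0‖) 0
    (fun i => (hcont.integrableOn_Icc).mono_set Set.Ioc_subset_Icc_self) tendsto_id ?_
  filter_upwards [eventually_ge_atTop 0] with R hR
  set P : ℝ → ℝ := fun x => (∫ s in (0 : ℝ)..x, ‖v s‖ / (1 + |s|)) - G x / (1 + x) with hP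
  have hPd : ∀ x ∈ Set.uIcc 0 R, HasDerivAt P (G x / (1 + |x|) ^ 2) x := by
    intro x hx
    rw [Set.uIcc_of_le hR] at hx
    have hx0 : 1 + x ≠ 0 := by linarith [hx.1]
    have h1 := (hwc.integral_hasStrictDerivAt 0 x).hasDerivAt
    have h2 := (hGd x).div ((hasDerivAt_id x).const_add 1) hx0
    refine (h1.sub h2).congr_deriv ?_
    rw [abs_of_nonneg hx.1]
    simp only [id]
    field_simp
    ring
  have hGcont : Continuous fun x : ℝ => G x / (1 + |x|) ^ 2 :=
    hGc.div (by fun_prop) fun x => pow_ne_zero _ (hden x)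
  have hFTC := intervalIntegral.integral_eq_sub_of_hasDerivAt hPd (hGcont.intervalIntegrable _ _)
  have hP0 : P 0 = -‖u 0‖ := by simp [hP, hG]
  have hPR : P R ≤ ∫ x : ℝ, ‖v x‖ / (1 + |x|) := by
    have h1 : 0 ≤ G R / (1 + R) := div_nonneg ((norm_nonneg _).trans (huG R hR)) (by linarith)
    have h2 : (∫ s in (0 : ℝ)..R, ‖v s‖ / (1 + |s|)) ≤ ∫ x : ℝ, ‖v x‖ / (1 + |x|) := by
      rw [intervalIntegral.integral_of_le hR]
      exact setIntegral_le_integral hint (Eventually.of_forall fun x => by positivity)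
    simp only [hP]
    linarith
  calc (∫ x in (0 : ℝ)..id R, ‖‖u x‖ / (1 + |x|) ^ 2‖)
      ≤ ∫ x in (0 : ℝ)..R, G x / (1 + |x|) ^ 2 := by
        refine intervalIntegral.integral_mono_on hR (hcont.norm.intervalIntegrable _ _)
          (hGcont.intervalIntegrable _ _) fun x hx => ?_
        rw [Real.norm_of_nonneg (by positivity)]
        gcongr
        exact huG x hx.1
    _ ≤ _ := by rw [hFTC, hP0]; linarith

/-- If `‖u'‖ / (1 + |x|)` is integrable then so is `‖u‖ / (1 + |x|) ^ 2`. -/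
lemma integrable_norm_div_sq {u v : ℝ → ℂ} (hu : ∀ x, HasDerivAt u (v x) x)
    (hv : Continuous v) (hint : Integrable fun x : ℝ => ‖v x‖ / (1 + |x|)) :
    Integrable (fun x : ℝ => ‖u x‖ / (1 + |x|) ^ 2) := by
  have h1 := integrableOn_Ioi_norm_div_sq hu hv hint
  have h2 := integrableOn_Ioi_norm_div_sq (u := fun x => u (-x)) (v := fun x => -v (-x))
    (fun x => ((hu (-x)).scomp x (hasDerivAt_neg x)).congr_deriv (neg_one_smul ℝ _))
    (by fun_prop) (by simpa using hint.comp_neg)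
  have h3 : IntegrableOn (fun x : ℝ => ‖u x‖ / (1 + |x|) ^ 2) (Set.Iio 0) := by
    rw [← integrable_indicator_iff measurableSet_Iio]
    rw [← integrable_indicator_iff measurableSet_Ioi] at h2
    refine h2.comp_neg.congr (Eventually.of_forall fun x => ?_)
    simp [Set.indicator]
  rw [← integrableOn_univ, ← Set.Iic_union_Ioi (a := (0 : ℝ))]
  exact ((integrableOn_Iic_iff_integrableOn_Iio).2 h3).union h1

lemma eventually_one_add_abs_le (a : ℝ) :
    ∀ᶠ x : ℝ in cocompact ℝ, 1 + |x| ≤ 2 * |x - a| := by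
  have := (tendsto_norm_cocompact_atTop (E := ℝ)).eventually_ge_atTop (2 * |a| + 1)
  filter_upwards [this] with x hx
  rw [Real.norm_eq_abs] at hx
  linarith [abs_sub_abs_le_abs_sub x a]

/-- The real line with `δ`-neighbourhoods of two points removed. -/
def puncturedLine (a b δ : ℝ) : Set ℝ := {ξ : ℝ | δ ≤ |ξ - a| ∧ δ ≤ |ξ - b|}

lemma measurableSet_le_abs_sub (a δ : ℝ) : MeasurableSet {ξ : ℝ | δ ≤ |ξ - a|} :=
  (isClosed_le continuous_const (by fun_prop)).measurableSet

lemma measurableSet_puncturedLine (a b δ : ℝ) : MeasurableSet (puncturedLine a b δ) :=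
  (measurableSet_le_abs_sub a δ).inter (measurableSet_le_abs_sub b δ)

lemma puncturedLine_comm (a b δ : ℝ) : puncturedLine a b δ = puncturedLine b a δ := by
  ext ξ
  exact and_comm

lemma tendsto_integral_puncturedLine {F : ℝ → ℂ} (hF : Integrable F) (a b : ℝ) :
    Tendsto (fun δ : ℝ => ∫ ξ in puncturedLine a b δ, F ξ) (𝓝[>] 0) (𝓝 (∫ ξ, F ξ)) := by
  simp_rw [← fun δ => integral_indicator (μ := volume) (f := F) (measurableSet_puncturedLine a b δ)]
  refine tendsto_integral_filter_of_dominated_convergence (fun x => ‖F x‖) ?_ ?_ hF.norm ?_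
  · exact Eventually.of_forall fun δ =>
      hF.aestronglyMeasurable.indicator (measurableSet_puncturedLine a b δ)
  · exact Eventually.of_forall fun δ => Eventually.of_forall fun x => norm_indicator_le_norm_self _ _
  · have hab : ∀ᵐ x : ℝ, x ∉ ({a, b} : Set ℝ) :=
      measure_eq_zero_iff_ae_notMem.1 ((Set.toFinite {a, b}).measure_zero volume)
    filter_upwards [hab] with x hx
    simp only [Set.mem_insert_iff, Set.mem_singleton_iff, not_or] at hx
    have h1 : 0 < |x - a| := abs_pos.2 (sub_ne_zero.2 hx.1)
    have h2 : 0 < |x - b| := abs_pos.2 (sub_ne_zero.2 hx.2)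
    refine tendsto_const_nhds.congr' ?_
    filter_upwards [nhdsWithin_le_nhds (eventually_lt_nhds h1),
      nhdsWithin_le_nhds (eventually_lt_nhds h2)] with δ hδ1 hδ2
    rw [Set.indicator_of_mem]
    exact ⟨hδ1.le, hδ2.le⟩

lemma integrableOn_inv_mul_one_add_sq (a : ℝ) {δ : ℝ} (hδ : 0 < δ) :
    IntegrableOn (fun ξ : ℝ => (((ξ - a)⁻¹ * (1 + (ξ - a) ^ 2)⁻¹ : ℝ) : ℂ))
      {ξ : ℝ | δ ≤ |ξ - a|} := by
  suffices h : IntegrableOn (fun ξ : ℝ => (ξ - a)⁻¹ * (1 + (ξ - a) ^ 2)⁻¹) {ξ : ℝ | δ ≤ |ξ - a|} from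
    Integrable.ofReal h
  have h1 : Integrable fun ξ : ℝ => (1 + (ξ - a) ^ 2)⁻¹ := integrable_inv_one_add_sq.comp_sub_right a
  refine Integrable.mono' (h1.integrableOn.const_mul δ⁻¹)
    (by fun_prop : Measurable _).aestronglyMeasurable ?_
  filter_upwards [ae_restrict_mem (measurableSet_le_abs_sub a δ)] with x hx
  have hx : δ ≤ |x - a| := hx
  rw [norm_mul, norm_inv, norm_inv, Real.norm_eq_abs, Real.norm_of_nonneg (by positivity)]
  gcongr

lemma setIntegral_inv_mul_one_add_sq (a δ : ℝ) :
    ∫ ξ in {ξ : ℝ | δ ≤ |ξ - a|}, (((ξ - a)⁻¹ * (1 + (ξ - a) ^ 2)⁻¹ : ℝ) : ℂ) = 0 := by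
  rw [← integral_indicator (measurableSet_le_abs_sub a δ)]
  set F : ℝ → ℂ := fun t => if δ ≤ |t| then ((t⁻¹ * (1 + t ^ 2)⁻¹ : ℝ) : ℂ) else 0 with hF
  have h1 : (Set.indicator {ξ : ℝ | δ ≤ |ξ - a|}
      fun ξ => (((ξ - a)⁻¹ * (1 + (ξ - a) ^ 2)⁻¹ : ℝ) : ℂ)) = fun ξ => F (ξ - a) := by
    ext ξ
    simp [hF, Set.indicator]
  have h2 : ∫ ξ, F (ξ - a) = ∫ ξ, F ξ := integral_sub_right_eq_self F a
  have h3 : ∫ ξ, F (-ξ) = ∫ ξ, F ξ := integral_neg_eq_self F volume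
  have h4 : ∀ ξ, F (-ξ) = -F ξ := by
    intro ξ
    simp only [hF, abs_neg, even_two, Even.neg_pow, inv_neg, neg_mul]
    split_ifs <;> simp
  simp_rw [h4, integral_neg] at h3
  rw [h1, h2]
  exact self_eq_neg.1 h3.symm

lemma tendsto_integral_puncturedLine_inv_mul {a b : ℝ} (hab : a ≠ b) :
    Tendsto (fun δ : ℝ => ∫ ξ in puncturedLine a b δ,
      (((ξ - a)⁻¹ * (1 + (ξ - a) ^ 2)⁻¹ : ℝ) : ℂ)) (𝓝[>] 0) (𝓝 0) := by
  set k : ℝ → ℂ := fun ξ => (((ξ - a)⁻¹ * (1 + (ξ - a) ^ 2)⁻¹ : ℝ) : ℂ) with hk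
  have hc : 0 < |a - b| / 2 := by have := abs_pos.2 (sub_ne_zero.2 hab); positivity
  have hlim : Tendsto (fun δ : ℝ => (|a - b| / 2)⁻¹ * (2 * δ)) (𝓝[>] 0) (𝓝 0) := by
    have : Continuous fun δ : ℝ => (|a - b| / 2)⁻¹ * (2 * δ) := by fun_prop
    simpa using (this.tendsto 0).mono_left nhdsWithin_le_nhds
  refine squeeze_zero_norm' ?_ hlim
  filter_upwards [self_mem_nhdsWithin, nhdsWithin_le_nhds (eventually_lt_nhds hc)] with δ hδ0 hδ
  have hδ0 : 0 < δ := hδ0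
  set T : Set ℝ := {ξ : ℝ | δ ≤ |ξ - a|} with hT
  have hsub : puncturedLine a b δ ⊆ T := fun x hx => hx.1
  have hdiff := setIntegral_sdiff (measurableSet_puncturedLine a b δ)
    (integrableOn_inv_mul_one_add_sq a hδ0) hsub
  rw [setIntegral_inv_mul_one_add_sq, zero_sub] at hdiff
  have hball : T \ puncturedLine a b δ ⊆ Metric.ball b δ := by
    rintro x ⟨hx1, hx2⟩
    rw [Metric.mem_ball, Real.dist_eq]
    by_contra h
    exact hx2 ⟨hx1, not_lt.1 h⟩
  have hfin : volume (T \ puncturedLine a b δ) < ⊤ :=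
    (measure_mono hball).trans_lt measure_ball_lt_top
  have hmeas : volume.real (T \ puncturedLine a b δ) ≤ 2 * δ := by
    refine (measureReal_mono hball measure_ball_lt_top.ne).trans ?_
    rw [Real.volume_real_ball hδ0.le]
  rw [← norm_neg, ← hdiff]
  refine (norm_setIntegral_le_of_norm_le_const (C := (|a - b| / 2)⁻¹) hfin fun x hx => ?_).trans
    (by gcongr)
  have hxb := hball hx
  rw [Metric.mem_ball, Real.dist_eq] at hxb
  have hxa : |a - b| / 2 ≤ |x - a| := by
    have h := abs_sub_le a x b
    rw [abs_sub_comm a x] at h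
    linarith
  rw [Complex.norm_real, norm_mul, norm_inv, Real.norm_eq_abs, norm_inv,
    Real.norm_of_nonneg (by positivity)]
  calc |x - a|⁻¹ * (1 + (x - a) ^ 2)⁻¹ ≤ (|a - b| / 2)⁻¹ * 1 := by
        gcongr
        exact inv_le_one_of_one_le₀ (by nlinarith [sq_nonneg (x - a)])
    _ = _ := mul_one _

lemma ofReal_add_I_ne_zero (t : ℝ) : (t : ℂ) + Complex.I ≠ 0 := fun h => by
  simpa using congrArg Complex.im h

lemma inv_sub_inv_add_I {t : ℝ} (ht : t ≠ 0) :
    1 / (t : ℂ) - 1 / ((t : ℂ) + Complex.I)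
      = Complex.I * (((1 + t ^ 2)⁻¹ : ℝ) : ℂ) + ((t⁻¹ * (1 + t ^ 2)⁻¹ : ℝ) : ℂ) := by
  have h1 : (t : ℂ) ≠ 0 := Complex.ofReal_ne_zero.2 ht
  have h2 := ofReal_add_I_ne_zero t
  have h3 : (1 + (t : ℂ) ^ 2) ≠ 0 := by
    have : (1 + t ^ 2 : ℝ) ≠ 0 := by positivity
    exact_mod_cast this
  push_cast
  field_simp
  ring_nf
  simp only [Complex.I_sq]
  ring

lemma integrableOn_puncturedLine_inv_sub_inv (a b : ℝ) {δ : ℝ} (hδ : 0 < δ) :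
    IntegrableOn (fun ξ : ℝ => 1 / ((ξ - a : ℝ) : ℂ) - 1 / (((ξ - a : ℝ) : ℂ) + Complex.I))
      (puncturedLine a b δ) := by
  have h1 : Integrable fun ξ : ℝ => (((1 + (ξ - a) ^ 2)⁻¹ : ℝ) : ℂ) :=
    (integrable_inv_one_add_sq.comp_sub_right a).ofReal
  have h2 := (integrableOn_inv_mul_one_add_sq a hδ).mono_set
    (fun x (hx : x ∈ puncturedLine a b δ) => hx.1)
  refine ((h1.const_mul Complex.I).integrableOn.add h2).congr_fun (fun x hx => ?_)
    (measurableSet_puncturedLine a b δ)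
  exact (inv_sub_inv_add_I (abs_pos.1 (hδ.trans_le hx.1))).symm

lemma tendsto_integral_puncturedLine_inv_sub_inv {a b : ℝ} (hab : a ≠ b) :
    Tendsto (fun δ : ℝ => ∫ ξ in puncturedLine a b δ,
      (1 / ((ξ - a : ℝ) : ℂ) - 1 / (((ξ - a : ℝ) : ℂ) + Complex.I)))
      (𝓝[>] 0) (𝓝 (Complex.I * Real.pi)) := by
  have h1 : Integrable fun ξ : ℝ => Complex.I * (((1 + (ξ - a) ^ 2)⁻¹ : ℝ) : ℂ) :=
    ((integrable_inv_one_add_sq.comp_sub_right a).ofReal).const_mul _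
  have hpi : ∫ ξ : ℝ, Complex.I * (((1 + (ξ - a) ^ 2)⁻¹ : ℝ) : ℂ) = Complex.I * Real.pi := by
    rw [integral_const_mul, integral_complex_ofReal,
      integral_sub_right_eq_self (fun ξ : ℝ => (1 + ξ ^ 2)⁻¹) a, integral_univ_inv_one_add_sq]
  have h2 := (tendsto_integral_puncturedLine h1 a b).add (tendsto_integral_puncturedLine_inv_mul hab)
  rw [hpi, add_zero] at h2
  refine h2.congr' ?_
  filter_upwards [self_mem_nhdsWithin] with δ hδ
  have hδ : 0 < δ := hδ
  rw [← integral_add h1.integrableOn ((integrableOn_inv_mul_one_add_sq a hδ).mono_set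
    (fun x (hx : x ∈ puncturedLine a b δ) => hx.1))]
  refine setIntegral_congr_fun (measurableSet_puncturedLine a b δ) fun x hx => ?_
  exact (inv_sub_inv_add_I (abs_pos.1 (hδ.trans_le hx.1))).symm

/-- The slope of `f` at the real point `a`, extended by the value `g a`, plus a correction with
pole in the lower half-plane chosen to cancel the `1 / z` term at infinity coming from `f a`. -/
noncomputable def regularizedSlope (f g : ℂ → ℂ) (a : ℝ) (z : ℂ) : ℂ :=
  Function.update (fun z : ℂ => (f z - f a) / (z - a)) a (g a) z + f a / (z - a + Complex.I)

lemma sub_add_I_ne_zero {a : ℝ} {z : ℂ} (hz : 0 ≤ z.im) : z - a + Complex.I ≠ 0 := fun h => by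
  have := congrArg Complex.im h
  simp at this
  linarith

lemma regularizedSlope_of_ne (f g : ℂ → ℂ) {a : ℝ} {z : ℂ} (hz : z ≠ a) :
    regularizedSlope f g a z
      = f z / (z - a) - f a * (1 / (z - a) - 1 / (z - a + Complex.I)) := by
  rw [regularizedSlope, Function.update_of_ne hz]
  ring

lemma continuousOn_regularizedSlope {f g : ℂ → ℂ}
    (hderiv : ∀ z : ℂ, 0 ≤ z.im → HasDerivWithinAt f (g z) {z : ℂ | 0 ≤ z.im} z) (a : ℝ) :
    ContinuousOn (regularizedSlope f g a) {z : ℂ | 0 ≤ z.im} := by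
  have hf : ContinuousOn f {z : ℂ | 0 ≤ z.im} := fun z hz => (hderiv z hz).continuousWithinAt
  refine ContinuousOn.add ?_ ?_
  · rw [continuousOn_update_iff]
    refine ⟨?_, fun ha => ?_⟩
    · refine ContinuousOn.div ((hf.mono Set.sdiff_subset).sub continuousOn_const) (by fun_prop) ?_
      intro z hz
      exact sub_ne_zero.2 hz.2
    · have := hasDerivWithinAt_iff_tendsto_slope.1 (hderiv a ha)
      exact this.congr fun z => slope_def_field f a z
  · exact ContinuousOn.div continuousOn_const (by fun_prop) fun z hz => sub_add_I_ne_zero hz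

lemma differentiableOn_regularizedSlope {f : ℂ → ℂ} (g : ℂ → ℂ)
    (hf : DifferentiableOn ℂ f {z : ℂ | 0 < z.im}) (a : ℝ) :
    DifferentiableOn ℂ (regularizedSlope f g a) {z : ℂ | 0 < z.im} := by
  have hne : ∀ z : ℂ, 0 < z.im → z ≠ a := by
    rintro z hz rfl
    simp at hz
  have hd : DifferentiableOn ℂ (fun z : ℂ => (f z - f a) / (z - a) + f a / (z - a + Complex.I))
      {z : ℂ | 0 < z.im} := by
    refine DifferentiableOn.add (DifferentiableOn.div (hf.sub_const _) (by fun_prop) ?_)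
      (DifferentiableOn.div (by fun_prop) (by fun_prop) ?_)
    · exact fun z hz => sub_ne_zero.2 (hne z hz)
    · exact fun z (hz : 0 < z.im) => sub_add_I_ne_zero hz.le
  refine hd.congr fun z hz => ?_
  rw [regularizedSlope, Function.update_of_ne (hne z hz)]

lemma tendsto_div_sub_cobounded (c : ℂ) :
    Tendsto (fun z : ℂ => z / (z - c)) (Bornology.cobounded ℂ) (𝓝 1) := by
  have h1 : Tendsto (fun z : ℂ => (1 - c * z⁻¹)⁻¹) (Bornology.cobounded ℂ) (𝓝 (1 - c * 0)⁻¹) :=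
    ((tendsto_inv₀_cobounded (α := ℂ)).const_mul c |>.const_sub 1).inv₀ (by simp)
  rw [mul_zero, sub_zero, inv_one] at h1
  refine h1.congr' ?_
  filter_upwards [Bornology.eventually_ne_cobounded (0 : ℂ)] with z hz
  have : 1 - c * z⁻¹ = (z - c) / z := by field_simp
  rw [this, inv_div]

lemma tendsto_mul_regularizedSlope_sub {f : ℂ → ℂ} (g : ℂ → ℂ)
    (hf : Tendsto (fun z => f z / z) (Bornology.cobounded ℂ ⊓ 𝓟 {z : ℂ | 0 ≤ z.im}) (𝓝 0))
    (a b : ℝ) :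
    Tendsto (fun z => z * (regularizedSlope f g a z - regularizedSlope f g b z))
      (Bornology.cobounded ℂ ⊓ 𝓟 {z : ℂ | 0 ≤ z.im}) (𝓝 0) := by
  have hT : ∀ c : ℂ, Tendsto (fun z : ℂ => z / (z - c))
      (Bornology.cobounded ℂ ⊓ 𝓟 {z : ℂ | 0 ≤ z.im}) (𝓝 1) := fun c =>
    (tendsto_div_sub_cobounded c).mono_left inf_le_left
  have h1 := ((hf.mul_const ((a : ℂ) - b)).mul (hT a)).mul (hT b)
  have h2 : ∀ c : ℝ, Tendsto (fun z : ℂ => f c * (z / (z - c) - z / (z - (c - Complex.I))))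
      (Bornology.cobounded ℂ ⊓ 𝓟 {z : ℂ | 0 ≤ z.im}) (𝓝 (f c * (1 - 1))) := fun c =>
    ((hT c).sub (hT _)).const_mul _
  have h3 := (h1.sub (h2 a)).add (h2 b)
  simp only [zero_mul, sub_self, mul_zero, add_zero] at h3
  refine h3.congr' ?_
  have hne : ∀ c : ℂ, ∀ᶠ z in Bornology.cobounded ℂ ⊓ 𝓟 {z : ℂ | 0 ≤ z.im}, z ≠ c := fun c =>
    (Bornology.eventually_ne_cobounded c).filter_mono inf_le_left
  filter_upwards [hne a, hne b, hne 0] with z hza hzb hz0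
  rw [regularizedSlope_of_ne f g hza, regularizedSlope_of_ne f g hzb]
  have e : f z / (z - a) - f z / (z - b) = f z * ((a : ℂ) - b) / ((z - a) * (z - b)) := by
    have := sub_ne_zero.2 hza
    have := sub_ne_zero.2 hzb
    field_simp
    ring
  have e2 : f z / z * ((a : ℂ) - b) * (z / (z - a)) * (z / (z - b))
      = z * (f z / (z - a) - f z / (z - b)) := by
    rw [e]
    have := sub_ne_zero.2 hza
    have := sub_ne_zero.2 hzb
    field_simp
  rw [e2, ← sub_add, ← sub_add]
  ring

lemma integrable_regularizedSlope_sub {f g : ℂ → ℂ}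
    (hderiv : ∀ z : ℂ, 0 ≤ z.im → HasDerivWithinAt f (g z) {z : ℂ | 0 ≤ z.im} z)
    (hf : Integrable fun x : ℝ => ‖f x‖ / (1 + |x|) ^ 2) (a b : ℝ) :
    Integrable fun x : ℝ => regularizedSlope f g a x - regularizedSlope f g b x := by
  have hcont : ∀ c : ℝ, Continuous fun x : ℝ => regularizedSlope f g c x := fun c =>
    (continuousOn_regularizedSlope hderiv c).comp_continuous Complex.continuous_ofReal
      fun x => by simp
  have hone : Integrable fun x : ℝ => 1 / (1 + |x|) ^ 2 := by
    simpa using integrable_norm_div_sq (u := fun _ => (1 : ℂ)) (v := fun _ => 0)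
      (fun x => hasDerivAt_const x 1) continuous_const (by simp)
  have hG : Integrable fun x : ℝ => 4 * |a - b| * (‖f x‖ / (1 + |x|) ^ 2)
      + 4 * (‖f a‖ + ‖f b‖) * (1 / (1 + |x|) ^ 2) :=
    (hf.const_mul _).add (hone.const_mul _)
  refine ((hcont a).sub (hcont b)).locallyIntegrable.integrable_of_isBigO_cocompact
    (Asymptotics.IsBigO.of_bound 1 ?_) (hG.integrableAtFilter _)
  filter_upwards [eventually_one_add_abs_le a, eventually_one_add_abs_le b] with x hxa hxb
  have hD : 0 < 1 + |x| := by positivity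
  have hxa0 : 0 < |x - a| := by linarith
  have hxb0 : 0 < |x - b| := by linarith
  have hne : ∀ c : ℝ, 0 < |x - c| → (x : ℂ) - c ≠ 0 := fun c hc => by
    have := abs_pos.1 hc
    exact_mod_cast this
  have hinv : ∀ c : ℝ, 1 + |x| ≤ 2 * |x - c| → 1 / ‖(x : ℂ) - c‖ ≤ 2 / (1 + |x|) := by
    intro c hc
    rw [← Complex.ofReal_sub, Complex.norm_real, Real.norm_eq_abs,
      div_le_div_iff₀ (by linarith) hD]
    linarith
  have hinv' : ∀ c : ℝ, 1 + |x| ≤ 2 * |x - c| →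
      1 / ‖(x : ℂ) - c + Complex.I‖ ≤ 2 / (1 + |x|) := by
    intro c hc
    have h1 := Complex.abs_re_le_norm ((x : ℂ) - c + Complex.I)
    simp only [Complex.add_re, Complex.sub_re, Complex.ofReal_re, Complex.I_re, add_zero] at h1
    rw [div_le_div_iff₀ (by linarith) hD]
    linarith
  have hq : ∀ c : ℝ, 1 + |x| ≤ 2 * |x - c| →
      ‖f c * (1 / ((x : ℂ) - c) - 1 / ((x : ℂ) - c + Complex.I))‖
        ≤ 4 * ‖f c‖ * (1 / (1 + |x|) ^ 2) := by
    intro c hc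
    have h1 := hne c (by linarith)
    have h2 : (x : ℂ) - c + Complex.I ≠ 0 := sub_add_I_ne_zero (by simp)
    have e : 1 / ((x : ℂ) - c) - 1 / ((x : ℂ) - c + Complex.I)
        = Complex.I * (1 / ((x : ℂ) - c)) * (1 / ((x : ℂ) - c + Complex.I)) := by
      field_simp
      ring
    rw [e, norm_mul, norm_mul, norm_mul, Complex.norm_I, one_mul, norm_div, norm_div, norm_one]
    calc _ ≤ ‖f c‖ * ((2 / (1 + |x|)) * (2 / (1 + |x|))) := by
          exact mul_le_mul_of_nonneg_left
            (mul_le_mul (hinv c hc) (hinv' c hc) (by positivity) (by positivity)) (by positivity)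
      _ = _ := by field_simp; ring
  have hh : ‖f x / ((x : ℂ) - a) - f x / ((x : ℂ) - b)‖
      ≤ 4 * |a - b| * (‖f x‖ / (1 + |x|) ^ 2) := by
    have h1 := hne a hxa0
    have h2 := hne b hxb0
    have e : f x / ((x : ℂ) - a) - f x / ((x : ℂ) - b)
        = f x * ((a : ℂ) - b) * ((1 / ((x : ℂ) - a)) * (1 / ((x : ℂ) - b))) := by
      field_simp
      ring
    have e2 : ‖(a : ℂ) - b‖ = |a - b| := by
      rw [← Complex.ofReal_sub, Complex.norm_real, Real.norm_eq_abs]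
    rw [e, norm_mul, norm_mul, norm_mul, norm_div, norm_div, norm_one, e2]
    calc _ ≤ ‖f x‖ * |a - b| * ((2 / (1 + |x|)) * (2 / (1 + |x|))) := by
          exact mul_le_mul_of_nonneg_left
            (mul_le_mul (hinv a hxa) (hinv b hxb) (by positivity) (by positivity)) (by positivity)
      _ = _ := by field_simp; ring
  rw [one_mul, Real.norm_of_nonneg (by positivity)]
  simp only [Pi.sub_apply]
  rw [regularizedSlope_of_ne f g (sub_ne_zero.1 (hne a hxa0)),
    regularizedSlope_of_ne f g (sub_ne_zero.1 (hne b hxb0))]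
  set qa := f a * (1 / ((x : ℂ) - a) - 1 / ((x : ℂ) - a + Complex.I)) with hqa
  set qb := f b * (1 / ((x : ℂ) - b) - 1 / ((x : ℂ) - b + Complex.I)) with hqb
  have e : f x / ((x : ℂ) - a) - qa - (f x / ((x : ℂ) - b) - qb)
      = (f x / ((x : ℂ) - a) - f x / ((x : ℂ) - b)) - qa + qb := by ring
  rw [e]
  calc _ ≤ ‖f x / ((x : ℂ) - a) - f x / ((x : ℂ) - b)‖ + ‖qa‖ + ‖qb‖ :=
        (norm_add_le _ _).trans (by gcongr; exact norm_sub_le _ _)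
    _ ≤ _ := by linarith [hq a hxa, hq b hxb]

/-- Complex form of the subtracted dispersion relation: the principal value integral of
`f ξ * (1 / (ξ - a) - 1 / (ξ - b))` is `iπ (f a - f b)`. -/
lemma tendsto_integral_puncturedLine_mul {f g : ℂ → ℂ}
    (hderiv : ∀ z : ℂ, 0 ≤ z.im → HasDerivWithinAt f (g z) {z : ℂ | 0 ≤ z.im} z)
    (hholo : DifferentiableOn ℂ f {z : ℂ | 0 < z.im})
    (hf : Integrable fun x : ℝ => ‖f x‖ / (1 + |x|) ^ 2)
    (hdecay : Tendsto g (Bornology.cobounded ℂ ⊓ 𝓟 {z : ℂ | 0 ≤ z.im}) (𝓝 0))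
    {a b : ℝ} (hab : a ≠ b) :
    (∀ δ : ℝ, 0 < δ → IntegrableOn
        (fun ξ : ℝ => f ξ * ((1 / (ξ - a) - 1 / (ξ - b) : ℝ) : ℂ)) (puncturedLine a b δ)) ∧
      Tendsto (fun δ : ℝ => ∫ ξ in puncturedLine a b δ,
        f ξ * ((1 / (ξ - a) - 1 / (ξ - b) : ℝ) : ℂ)) (𝓝[>] 0)
        (𝓝 (Complex.I * Real.pi * (f a - f b))) := by
  set B : ℂ → ℂ := fun z => regularizedSlope f g a z - regularizedSlope f g b z with hB
  have hBint : Integrable fun x : ℝ => B x := integrable_regularizedSlope_sub hderiv hf a b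
  have hBzero : ∫ x : ℝ, B x = 0 := by
    have h1 := tendsto_integral_real_zero_of_holomorphic (B := B)
      ((continuousOn_regularizedSlope hderiv a).sub (continuousOn_regularizedSlope hderiv b))
      ((differentiableOn_regularizedSlope g hholo a).sub
        (differentiableOn_regularizedSlope g hholo b))
      (tendsto_mul_regularizedSlope_sub g
        (tendsto_div_id_of_deriv_tendsto_zero hderiv hdecay) a b)
    exact tendsto_nhds_unique
      (intervalIntegral_tendsto_integral hBint tendsto_neg_atTop_atBot tendsto_id) h1
  set q : ℝ → ℝ → ℂ := fun c ξ =>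
    1 / ((ξ - c : ℝ) : ℂ) - 1 / (((ξ - c : ℝ) : ℂ) + Complex.I) with hq
  have hqa : ∀ δ : ℝ, 0 < δ → IntegrableOn (q a) (puncturedLine a b δ) := fun δ hδ =>
    integrableOn_puncturedLine_inv_sub_inv a b hδ
  have hqb : ∀ δ : ℝ, 0 < δ → IntegrableOn (q b) (puncturedLine a b δ) := fun δ hδ => by
    rw [puncturedLine_comm]
    exact integrableOn_puncturedLine_inv_sub_inv b a hδ
  have heq : ∀ δ : ℝ, 0 < δ → Set.EqOn (fun ξ : ℝ => B ξ + f a * q a ξ - f b * q b ξ)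
      (fun ξ : ℝ => f ξ * ((1 / (ξ - a) - 1 / (ξ - b) : ℝ) : ℂ)) (puncturedLine a b δ) := by
    intro δ hδ ξ hξ
    have hne : ∀ c : ℝ, δ ≤ |ξ - c| → (ξ : ℂ) ≠ c := fun c hc => by
      have := sub_ne_zero.1 (abs_pos.1 (hδ.trans_le hc))
      exact_mod_cast this
    simp only [hB, hq]
    rw [regularizedSlope_of_ne f g (hne a hξ.1), regularizedSlope_of_ne f g (hne b hξ.2)]
    push_cast
    ring
  have hint : ∀ δ : ℝ, 0 < δ → IntegrableOn
      (fun ξ : ℝ => B ξ + f a * q a ξ - f b * q b ξ) (puncturedLine a b δ) := fun δ hδ =>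
    (hBint.integrableOn.add ((hqa δ hδ).const_mul _)).sub ((hqb δ hδ).const_mul _)
  refine ⟨fun δ hδ => (hint δ hδ).congr_fun (heq δ hδ) (measurableSet_puncturedLine a b δ), ?_⟩
  have hlim_a : Tendsto (fun δ : ℝ => ∫ ξ in puncturedLine a b δ, q a ξ) (𝓝[>] 0)
      (𝓝 (Complex.I * Real.pi)) := tendsto_integral_puncturedLine_inv_sub_inv hab
  have hlim_b : Tendsto (fun δ : ℝ => ∫ ξ in puncturedLine a b δ, q b ξ) (𝓝[>] 0)
      (𝓝 (Complex.I * Real.pi)) := by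
    simp_rw [puncturedLine_comm a b]
    exact tendsto_integral_puncturedLine_inv_sub_inv hab.symm
  have hlim := ((tendsto_integral_puncturedLine hBint a b).add (hlim_a.const_mul (f a))).sub
    (hlim_b.const_mul (f b))
  rw [hBzero] at hlim
  have e : 0 + f a * (Complex.I * Real.pi) - f b * (Complex.I * Real.pi)
      = Complex.I * Real.pi * (f a - f b) := by ring
  rw [e] at hlim
  refine hlim.congr' ?_
  filter_upwards [self_mem_nhdsWithin] with δ hδ
  have hδ : 0 < δ := hδ
  rw [← setIntegral_congr_fun (measurableSet_puncturedLine a b δ) (heq δ hδ),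
    integral_sub (f := fun ξ : ℝ => B ξ + f a * q a ξ)
      (hBint.integrableOn.add ((hqa δ hδ).const_mul _)) ((hqb δ hδ).const_mul _),
    integral_add hBint.integrableOn ((hqa δ hδ).const_mul _), integral_const_mul,
    integral_const_mul]

/-- Once-subtracted dispersion relations: if the derivative of a function holomorphic
on the upper half-plane extends continuously to the closed half-plane with integrable
decay, then the boundary values satisfy subtracted principal-value dispersion
relations. -/
theorem stmt_14 (f g : ℂ → ℂ)
    (hcont : ContinuousOn f {z : ℂ | 0 ≤ z.im})
    (hholo : DifferentiableOn ℂ f {z : ℂ | 0 < z.im})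
    (hC2 : ContDiff ℝ 2 (fun ξ : ℝ => f (ξ : ℂ)))
    (hgcont : ContinuousOn g {z : ℂ | 0 ≤ z.im})
    (hgderiv : ∀ z : ℂ, 0 < z.im → HasDerivAt f (g z) z)
    (hgbd : ∀ ξ : ℝ, g (ξ : ℂ) = deriv (fun s : ℝ => f (s : ℂ)) ξ)
    (hint : Integrable (fun ξ : ℝ => ‖g (ξ : ℂ)‖ / (1 + |ξ|)))
    (hdecay : Tendsto g (Bornology.cobounded ℂ ⊓ Filter.principal {z : ℂ | 0 ≤ z.im})
      (𝓝 0)) :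
    ∀ E : ℝ,
      Tendsto (fun δ : ℝ => ∫ ξ in {ξ : ℝ | δ ≤ |ξ - E| ∧ δ ≤ |ξ|},
          (f (ξ : ℂ)).im * (1 / (ξ - E) - 1 / ξ))
        (𝓝[>] (0 : ℝ)) (𝓝 (Real.pi * ((f (E : ℂ)).re - (f 0).re)))
      ∧ Tendsto (fun δ : ℝ => ∫ ξ in {ξ : ℝ | δ ≤ |ξ - E| ∧ δ ≤ |ξ|},
          (f (ξ : ℂ)).re * (1 / (ξ - E) - 1 / ξ))
        (𝓝[>] (0 : ℝ)) (𝓝 (-(Real.pi * ((f (E : ℂ)).im - (f 0).im)))) := by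
  intro E
  rcases eq_or_ne E 0 with rfl | hE
  · simp
  have hderiv : ∀ z : ℂ, 0 ≤ z.im → HasDerivWithinAt f (g z) {z : ℂ | 0 ≤ z.im} z :=
    fun z hz => hasDerivWithinAt_closed_upper hcont hgcont hgderiv hz
  have hu : ∀ x : ℝ, HasDerivAt (fun s : ℝ => f s) (g x) x := fun x => by
    rw [hgbd x]
    exact (hC2.differentiable (by norm_num) x).hasDerivAt
  have hv : Continuous fun x : ℝ => g x :=
    hgcont.comp_continuous Complex.continuous_ofReal fun x => by simp
  obtain ⟨hI, hL⟩ := tendsto_integral_puncturedLine_mul hderiv hholo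
    (integrable_norm_div_sq hu hv hint) hdecay hE
  have hset : ∀ δ : ℝ, {ξ : ℝ | δ ≤ |ξ - E| ∧ δ ≤ |ξ|} = puncturedLine E 0 δ := fun δ => by
    simp [puncturedLine]
  simp only [hset]
  constructor
  · have h1 := (Complex.continuous_im.tendsto _).comp hL
    have e : (Complex.I * Real.pi * (f E - f (0 : ℝ))).im
        = Real.pi * ((f (E : ℂ)).re - (f 0).re) := by simp
    rw [e] at h1
    refine h1.congr' ?_
    filter_upwards [self_mem_nhdsWithin] with δ hδ
    refine (integral_im (hI δ hδ)).symm.trans (integral_congr_ae (Eventually.of_forall fun ξ => ?_))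
    simp only [RCLike.im_eq_complex_im, Complex.im_mul_ofReal, sub_zero]
  · have h1 := (Complex.continuous_re.tendsto _).comp hL
    have e : (Complex.I * Real.pi * (f E - f (0 : ℝ))).re
        = -(Real.pi * ((f (E : ℂ)).im - (f 0).im)) := by simp
    rw [e] at h1
    refine h1.congr' ?_
    filter_upwards [self_mem_nhdsWithin] with δ hδ
    refine (integral_re (hI δ hδ)).symm.trans (integral_congr_ae (Eventually.of_forall fun ξ => ?_))
    simp only [RCLike.re_eq_complex_re, Complex.re_mul_ofReal, sub_zero]
end
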